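/- arXiv:2001.03471 — 7 statements merged into one kernel-verified Lean document; each statement's English description precedes it below -/
import Mathlib

section
/- Let p be an odd prime. Then Σ_{k=1}^{p-2} B_k/(k·2^k) ≡ (p·B_{p-1} + 1)/p + 2(N_{p-2} − 1) (mod p), i.e. the powers-of-two weighted sum of the first p−2 divided Bernoulli numbers is congruent modulo p to the Agoh–Giuga quotient plus twice the number of permutations of {1,…,p−2} with an even number of ascents and distinct from the identity. -/
/-- The number of ascents of a permutation of `Fin n` (positions `i` with `σ i < σ (i+1)`). -/
def numAscents {n : ℕ} (σ : Equiv.Perm (Fin n)) : ℕ :=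
  (Finset.univ.filter (fun i : Fin (n - 1) =>
    σ ⟨i.val, by have := i.isLt; omega⟩ < σ ⟨i.val + 1, by have := i.isLt; omega⟩)).card

/-- The number of permutations of `Fin n` with an even number of ascents. -/
def evenAscentPerms (n : ℕ) : ℕ :=
  (Finset.univ.filter (fun σ : Equiv.Perm (Fin n) => Even (numAscents σ))).card

/-- The Eulerian number `E(n, m)`: permutations of `Fin n` with exactly `m` ascents. -/
def eulerian (n m : ℕ) : ℕ :=
  (Finset.univ.filter (fun σ : Equiv.Perm (Fin n) => numAscents σ = m)).card

/-- `x ≡ 0 (mod p^k)` for a rational `x`: either `x = 0` or the `p`-adic valuation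
of `x` is at least `k`. -/
def PadicDvd (p k : ℕ) (x : ℚ) : Prop :=
  x = 0 ∨ (k : ℤ) ≤ padicValRat p x

/-- The number of ascents of `σ` at positions before `i`. -/
def ascentsBefore {k : ℕ} (σ : Equiv.Perm (Fin (k + 1))) (i : Fin (k + 1)) : ℕ :=
  (Finset.univ.filter (fun a : Fin k => a.castSucc < i ∧ σ a.castSucc < σ a.succ)).card

lemma ascentsBefore_zero {k : ℕ} (σ : Equiv.Perm (Fin (k + 1))) : ascentsBefore σ 0 = 0 := by
  simp [ascentsBefore]

lemma ascentsBefore_last {k : ℕ} (σ : Equiv.Perm (Fin (k + 1))) :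
    ascentsBefore σ (Fin.last k) = numAscents σ := by
  simp only [ascentsBefore, Fin.castSucc_lt_last, true_and]
  rfl

lemma ascentsBefore_succ {k : ℕ} (σ : Equiv.Perm (Fin (k + 1))) (a : Fin k) :
    ascentsBefore σ a.succ =
      ascentsBefore σ a.castSucc + if σ a.castSucc < σ a.succ then 1 else 0 := by
  have hsplit : ∀ b : Fin k, (b.castSucc < a.succ ∧ σ b.castSucc < σ b.succ) ↔
      ((b.castSucc < a.castSucc ∧ σ b.castSucc < σ b.succ) ∨
        (b = a ∧ σ a.castSucc < σ a.succ)) := by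
    intro b
    rw [Fin.castSucc_lt_succ_iff, le_iff_lt_or_eq, Fin.castSucc_lt_castSucc_iff]
    constructor
    · rintro ⟨h | rfl, h'⟩
      · exact Or.inl ⟨h, h'⟩
      · exact Or.inr ⟨rfl, h'⟩
    · rintro (⟨h, h'⟩ | ⟨rfl, h'⟩)
      · exact ⟨Or.inl h, h'⟩
      · exact ⟨Or.inr rfl, h'⟩
  unfold ascentsBefore
  simp only [hsplit]
  rw [Finset.filter_or, Finset.card_union_of_disjoint]
  · congr 1
    split_ifs with h
    · simp [h, Finset.filter_eq']
    · simp [h]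
  · rw [Finset.disjoint_filter]
    rintro b - ⟨hb, -⟩ ⟨rfl, -⟩
    exact lt_irrefl _ hb

/-- Tuples in `Fin m` that become strictly increasing after adding `d` correspond to
`(k + 1)`-subsets of `range (m + d (Fin.last k))`. -/
lemma card_filter_strictMono_add {k : ℕ} (m : ℕ) (d : Fin (k + 1) → ℕ) (h0 : d 0 = 0)
    (hmono : ∀ a : Fin k, d a.castSucc ≤ d a.succ)
    (hstep : ∀ a : Fin k, d a.succ ≤ d a.castSucc + 1) :
    (Finset.univ.filter (fun h : Fin (k + 1) → Fin m =>
      StrictMono (fun i => (h i : ℕ) + d i))).card = (m + d (Fin.last k)).choose (k + 1) := by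
  have hd : Monotone d := Fin.monotone_iff_le_succ.2 hmono
  rw [← Finset.card_range (m + d (Fin.last k)), ← Finset.card_powersetCard]
  refine Finset.card_bij (fun h _ => Finset.univ.image (fun i => (h i : ℕ) + d i)) ?_ ?_ ?_
  · intro h hh
    rw [Finset.mem_filter] at hh
    rw [Finset.mem_powersetCard]
    refine ⟨?_, ?_⟩
    · intro x hx
      obtain ⟨i, -, rfl⟩ := Finset.mem_image.1 hx
      have := hd (Fin.le_last i)
      have := (h i).isLt
      simp only [Finset.mem_range]
      omega
    · rw [Finset.card_image_of_injective _ hh.2.injective, Finset.card_univ, Fintype.card_fin]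
  · intro h hh h' hh' heq
    rw [Finset.mem_filter] at hh hh'
    have hr := congrArg (fun s : Finset ℕ => (s : Set ℕ)) heq
    simp only [Finset.coe_image, Finset.coe_univ, Set.image_univ] at hr
    have hfun := (StrictMono.range_inj hh.2 hh'.2).1 hr
    ext i
    have := congrFun hfun i
    omega
  · intro s hs
    rw [Finset.mem_powersetCard] at hs
    set e := s.orderEmbOfFin hs.2 with he
    have hsub : Monotone (fun i => (e i : ℤ) - d i) := by
      refine Fin.monotone_iff_le_succ.2 fun a => ?_
      have h1 : e a.castSucc < e a.succ := e.strictMono Fin.castSucc_lt_succ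
      have h2 := hstep a
      omega
    have hle : ∀ i, d i ≤ e i := by
      intro i
      have := hsub (Fin.zero_le i)
      simp only [h0] at this
      omega
    have hlt : ∀ i, e i - d i < m := by
      intro i
      have h1 := hsub (Fin.le_last i)
      have h2 := Finset.mem_range.1 (hs.1 (s.orderEmbOfFin_mem hs.2 (Fin.last k)))
      rw [← he] at h2
      have h3 := hle i
      simp only at h1
      omega
    have hfun : (fun i => (e i - d i) + d i) = e := funext fun i => Nat.sub_add_cancel (hle i)
    refine ⟨fun i => ⟨e i - d i, hlt i⟩, ?_, ?_⟩
    · rw [Finset.mem_filter]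
      refine ⟨Finset.mem_univ _, ?_⟩
      simp only [hfun]
      exact e.strictMono
    · simp only [hfun]
      rw [← Finset.coe_inj, Finset.coe_image, Finset.coe_univ, Set.image_univ, he,
        Finset.range_orderEmbOfFin]

lemma strictMono_toLex_iff {k m : ℕ} (σ : Equiv.Perm (Fin (k + 1))) (h : Fin (k + 1) → Fin m) :
    StrictMono (fun i => toLex (h i, σ i)) ↔
      StrictMono (fun i => (h i : ℕ) + ascentsBefore σ i) := by
  rw [Fin.strictMono_iff_lt_succ, Fin.strictMono_iff_lt_succ]
  refine forall_congr' fun a => ?_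
  rw [Prod.Lex.toLex_lt_toLex, ascentsBefore_succ]
  split_ifs with hlt
  · simp only [hlt, and_true, Fin.lt_def, Fin.ext_iff]
    omega
  · simp only [hlt, and_false, or_false, Fin.lt_def]
    omega

lemma eq_sort_iff_strictMono_toLex {n m : ℕ} (σ : Equiv.Perm (Fin n)) (g : Fin n → Fin m) :
    σ = Tuple.sort g ↔ StrictMono (fun i => toLex ((g ∘ σ) i, σ i)) := by
  rw [Tuple.eq_sort_iff]
  constructor
  · rintro ⟨hm, hs⟩ i j hij
    rw [Prod.Lex.toLex_lt_toLex]
    rcases (hm hij.le).lt_or_eq with h | h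
    · exact Or.inl h
    · exact Or.inr ⟨h, hs i j hij h⟩
  · intro h
    refine ⟨fun i j hij => ?_, fun i j hij he => ?_⟩
    · exact (Prod.Lex.toLex_le_toLex'.1 (h.monotone hij)).1
    · rcases Prod.Lex.toLex_lt_toLex.1 (h hij) with h' | h'
      · exact absurd he h'.ne
      · exact h'.2

/-- Worpitzky's identity, as a sum over permutations. -/
theorem sum_choose_add_numAscents (k m : ℕ) :
    ∑ σ : Equiv.Perm (Fin (k + 1)), (m + numAscents σ).choose (k + 1) = m ^ (k + 1) := by
  have hcard : Fintype.card (Fin (k + 1) → Fin m) = m ^ (k + 1) := by simp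
  rw [← hcard, ← Finset.card_univ, Finset.card_eq_sum_card_fiberwise
    (f := fun g : Fin (k + 1) → Fin m => Tuple.sort g) (t := Finset.univ) (by simp)]
  refine Finset.sum_congr rfl fun σ _ => ?_
  rw [← ascentsBefore_last, ← card_filter_strictMono_add m _ (ascentsBefore_zero σ)
    (fun a => by rw [ascentsBefore_succ]; omega)
    (fun a => by rw [ascentsBefore_succ]; split_ifs <;> omega)]
  refine Finset.card_bij' (fun h _ => h ∘ σ.symm) (fun g _ => g ∘ σ) ?_ ?_ ?_ ?_
  · intro h hh
    rw [Finset.mem_filter, ← strictMono_toLex_iff] at hh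
    rw [Finset.mem_filter, eq_comm, eq_sort_iff_strictMono_toLex]
    refine ⟨Finset.mem_univ _, ?_⟩
    simpa [Function.comp_def] using hh.2
  · intro g hg
    rw [Finset.mem_filter, eq_comm, eq_sort_iff_strictMono_toLex] at hg
    rw [Finset.mem_filter, ← strictMono_toLex_iff]
    exact ⟨Finset.mem_univ _, hg.2⟩
  · intro h _
    ext i
    simp
  · intro g _
    ext i
    simp

lemma natCast_choose_eq_ite (p : ℕ) [hp : Fact p.Prime] (hp3 : 3 ≤ p) {r : ℕ}
    (hr : r + 3 ≤ 2 * p) :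
    (r.choose (p - 2) : ZMod p) = (if r = p - 2 then 1 else 0) - (if r = p - 1 then 1 else 0) := by
  rcases lt_trichotomy r (p - 2) with h | h | h
  · rw [Nat.choose_eq_zero_of_lt h, if_neg (by omega), if_neg (by omega)]
    simp
  · rw [if_pos h, if_neg (by omega), h]
    simp
  · rw [if_neg h.ne']
    split_ifs with h1
    · rw [h1, show p - 2 = p - 1 - 1 by omega, Nat.choose_symm (by omega), Nat.choose_one_right,
        Nat.cast_sub (by omega)]
      simp
    · rw [sub_zero, ZMod.natCast_eq_zero_iff]
      exact hp.out.dvd_choose (by omega) (by omega) (by omega)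

lemma sum_odd_choose_add (p : ℕ) [hp : Fact p.Prime] (hodd : Odd p) {a : ℕ} (ha : a + 3 ≤ p) :
    ∑ m ∈ (Finset.range (p - 1)).filter Odd, ((m + a).choose (p - 2) : ZMod p) =
      if Even a then 1 else -1 := by
  have hp3 : 3 ≤ p := by omega
  rw [Finset.sum_congr rfl fun m hm => natCast_choose_eq_ite p hp3 (r := m + a) (by
    have := Finset.mem_range.1 (Finset.mem_filter.1 hm).1
    omega), Finset.sum_sub_distrib, Finset.sum_ite, Finset.sum_ite]
  simp only [Finset.sum_const, nsmul_eq_mul, mul_one, mul_zero, add_zero]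
  have hcount : ∀ b, a < b → b < p → (((Finset.range (p - 1)).filter Odd).filter
      fun m => m + a = b) = if Odd (b - a) ∧ b - a < p - 1 then {b - a} else ∅ := by
    intro b hab hb
    ext m
    split_ifs with h
    · simp only [Finset.mem_filter, Finset.mem_range, Finset.mem_singleton]
      constructor
      · omega
      · rintro rfl
        exact ⟨⟨h.2, h.1⟩, by omega⟩
    · simp only [Finset.mem_filter, Finset.mem_range, Finset.notMem_empty, iff_false]
      rintro ⟨⟨h1, h2⟩, h3⟩
      have : m = b - a := by omega
      exact h (this ▸ ⟨h2, h1⟩)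
  rw [hcount _ (by omega) (by omega), hcount _ (by omega) (by omega)]
  obtain ⟨t, ht⟩ := hodd
  rcases Nat.even_or_odd a with he | ho
  · obtain ⟨s, hs⟩ := he
    rw [if_pos (⟨⟨t - 1 - s, by omega⟩, by omega⟩ : Odd (p - 2 - a) ∧ p - 2 - a < p - 1),
      if_neg, if_pos ⟨s, hs⟩]
    · simp
    · rintro ⟨⟨u, hu⟩, -⟩
      omega
  · rw [if_neg (Nat.not_even_iff_odd.2 ho)]
    obtain ⟨s, hs⟩ := ho
    rw [if_pos (⟨⟨t - 1 - s, by omega⟩, by omega⟩ : Odd (p - 1 - a) ∧ p - 1 - a < p - 1),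
      if_neg]
    · simp
    · rintro ⟨⟨u, hu⟩, -⟩
      omega

lemma numAscents_le {n : ℕ} (σ : Equiv.Perm (Fin n)) : numAscents σ ≤ n - 1 :=
  (Finset.card_le_univ _).trans (Fintype.card_fin _).le

lemma natCast_factorial_prime_sub_two (p : ℕ) [hp : Fact p.Prime] :
    ((p - 2).factorial : ZMod p) = 1 := by
  have h := ZMod.wilsons_lemma p
  have h2 := hp.out.two_le
  rw [show p - 1 = (p - 2) + 1 by omega, Nat.factorial_succ, show p - 2 + 1 = p - 1 by omega,
    Nat.cast_mul, Nat.cast_sub (by omega)] at h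
  simpa using h

/-- Modulo an odd prime `p`, the sum of the inverses of the odd numbers below `p` is the signed
count of the permutations of `p - 2` letters by parity of the number of ascents. -/
lemma sum_odd_pow_eq_two_mul_evenAscentPerms_sub_one (p : ℕ) [hp : Fact p.Prime] (hodd : Odd p) :
    ∑ m ∈ (Finset.range (p - 1)).filter Odd, (m : ZMod p) ^ (p - 2) =
      2 * (evenAscentPerms (p - 2) : ZMod p) - 1 := by
  have hp3 : 3 ≤ p := by
    have := hp.out.two_le
    obtain ⟨t, ht⟩ := hodd
    omega
  have hk : p - 2 = (p - 3) + 1 := by omega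
  have hW : ∀ m : ℕ, (m : ZMod p) ^ (p - 2) =
      ∑ σ : Equiv.Perm (Fin (p - 2)), ((m + numAscents σ).choose (p - 2) : ZMod p) := by
    intro m
    rw [hk]
    exact_mod_cast congrArg (Nat.cast (R := ZMod p)) (sum_choose_add_numAscents (p - 3) m).symm
  simp only [hW]
  rw [Finset.sum_comm, Finset.sum_congr rfl fun σ _ => sum_odd_choose_add p hodd
    (a := numAscents σ) (by have := numAscents_le σ; omega)]
  have hsign : ∀ σ : Equiv.Perm (Fin (p - 2)), (if Even (numAscents σ) then (1 : ZMod p) else -1) =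
      2 * (if Even (numAscents σ) then 1 else 0) - 1 := by
    intro σ
    split_ifs <;> norm_num
  simp only [hsign]
  rw [Finset.sum_sub_distrib, ← Finset.mul_sum, Finset.sum_boole, Finset.sum_const,
    Finset.card_univ, Fintype.card_perm, Fintype.card_fin, nsmul_eq_mul, mul_one,
    natCast_factorial_prime_sub_two]
  rfl

lemma natCast_choose_prime_sub_one (p : ℕ) [hp : Fact p.Prime] {j : ℕ} (hj : j < p) :
    ((p - 1).choose j : ZMod p) = (-1) ^ j := by
  induction j with
  | zero => simp
  | succ j ih =>
    have h := Nat.choose_succ_succ' (p - 1) j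
    rw [Nat.sub_add_cancel hp.out.one_le] at h
    have h0 : (p.choose (j + 1) : ZMod p) = 0 :=
      (ZMod.natCast_eq_zero_iff _ _).2 (hp.out.dvd_choose_self (by omega) hj)
    rw [h, Nat.cast_add, ih (by omega)] at h0
    rw [pow_succ]
    linear_combination h0

lemma sum_odd_choose {n : ℕ} (hn : n ≠ 0) :
    ∑ k ∈ (Finset.range (n + 1)).filter Odd, n.choose k = 2 ^ (n - 1) := by
  have h1 := Nat.sum_range_choose n
  have h2 := Int.alternating_sum_range_choose_of_ne hn
  have h3 : ∀ k ∈ Finset.range (n + 1), ((n.choose k : ℕ) : ℤ) - (-1) ^ k * n.choose k =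
      2 * if Odd k then (n.choose k : ℤ) else 0 := by
    intro k _
    split_ifs with h
    · rw [h.neg_one_pow]; ring
    · rw [(Nat.not_odd_iff_even.1 h).neg_one_pow]; ring
  have h4 := Finset.sum_congr rfl h3
  rw [Finset.sum_sub_distrib, h2, ← Finset.mul_sum, ← Finset.sum_filter] at h4
  have h5 : (2 : ℤ) ^ n = 2 * 2 ^ (n - 1) := by
    rw [← pow_succ', Nat.sub_add_cancel (Nat.one_le_iff_ne_zero.2 hn)]
  zify at h1 ⊢
  linarith

lemma natCast_choose_div_prime (p : ℕ) [hp : Fact p.Prime] {k : ℕ} (hk : Odd k) (hkp : k < p) :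
    ((p.choose k / p : ℕ) : ZMod p) = (k : ZMod p) ^ (p - 2) := by
  have hk0 : k ≠ 0 := by rintro rfl; simp at hk
  have hdvd : p ∣ p.choose k := hp.out.dvd_choose_self hk0 hkp
  have hmul : k * (p.choose k / p) = (p - 1).choose (k - 1) := by
    have h := Nat.add_one_mul_choose_eq (p - 1) (k - 1)
    rw [Nat.sub_add_cancel hp.out.one_le, Nat.sub_add_cancel (Nat.one_le_iff_ne_zero.2 hk0)] at h
    apply Nat.eq_of_mul_eq_mul_left hp.out.pos
    rw [h, mul_left_comm, Nat.mul_div_cancel' hdvd, mul_comm]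
  have hc := congrArg (Nat.cast (R := ZMod p)) hmul
  have heven : Even (k - 1) := by
    obtain ⟨t, rfl⟩ := hk
    simp
  rw [natCast_choose_prime_sub_one p (by omega), heven.neg_one_pow, Nat.cast_mul] at hc
  have hkne : (k : ZMod p) ≠ 0 := by
    rw [Ne, ZMod.natCast_eq_zero_iff]
    exact Nat.not_dvd_of_pos_of_lt (Nat.pos_of_ne_zero hk0) hkp
  have hfermat := ZMod.pow_card_sub_one_eq_one hkne
  have h2 := hp.out.two_le
  rw [show p - 1 = p - 2 + 1 by omega, pow_succ'] at hfermat
  exact mul_left_cancel₀ hkne (hc.trans hfermat.symm)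

/-- The Fermat quotient of `2` is the signed count of permutations of `p - 2` letters. -/
lemma padicNorm_fermatQuotient_sub_lt_one (p : ℕ) [hp : Fact p.Prime] (hodd : Odd p) :
    padicNorm p (((2 : ℚ) ^ (p - 1) - 1) / p - (2 * (evenAscentPerms (p - 2) : ℚ) - 1)) < 1 := by
  have hp0 : (p : ℚ) ≠ 0 := Nat.cast_ne_zero.2 hp.out.ne_zero
  have h2 := hp.out.two_le
  set S := (Finset.range (p - 1)).filter Odd with hS
  have hset : (Finset.range (p + 1)).filter Odd = insert p S := by
    ext m
    simp only [hS, Finset.mem_filter, Finset.mem_range, Finset.mem_insert]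
    constructor
    · rintro ⟨h1, h3⟩
      by_cases hm : m = p
      · exact Or.inl hm
      · refine Or.inr ⟨?_, h3⟩
        obtain ⟨t, ht⟩ := hodd
        obtain ⟨s, hs⟩ := h3
        omega
    · rintro (rfl | ⟨h1, h3⟩)
      · exact ⟨by omega, hodd⟩
      · exact ⟨by omega, h3⟩
  have hsum := sum_odd_choose hp.out.ne_zero
  rw [hset, Finset.sum_insert (by simp [hS]), Nat.choose_self] at hsum
  have hterm : ∀ k ∈ S, p.choose k = p * (p.choose k / p) := by
    intro k hk
    rw [hS, Finset.mem_filter, Finset.mem_range] at hk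
    have hk0 : k ≠ 0 := by rintro rfl; simp at hk
    exact (Nat.mul_div_cancel' (hp.out.dvd_choose_self hk0 (by omega))).symm
  rw [Finset.sum_congr rfl hterm, ← Finset.mul_sum] at hsum
  have hq : ((2 : ℚ) ^ (p - 1) - 1) / p = ((∑ k ∈ S, p.choose k / p : ℕ) : ℚ) := by
    rw [div_eq_iff hp0]
    have := congrArg (Nat.cast (R := ℚ)) hsum
    push_cast at this ⊢
    linarith
  have hz : (((∑ k ∈ S, p.choose k / p : ℕ) : ℤ) - (2 * (evenAscentPerms (p - 2) : ℤ) - 1) :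
      ℤ) = ((∑ k ∈ S, p.choose k / p : ℕ) : ℚ) - (2 * (evenAscentPerms (p - 2) : ℚ) - 1) := by
    generalize (∑ k ∈ S, p.choose k / p) = T
    push_cast
    ring
  rw [hq, ← hz, padicNorm.int_lt_one_iff, ← ZMod.intCast_zmod_eq_zero_iff_dvd]
  have hmod := sum_odd_pow_eq_two_mul_evenAscentPerms_sub_one p hodd
  rw [← hS, ← Finset.sum_congr rfl fun k hk => natCast_choose_div_prime p
    (Finset.mem_filter.1 hk).2 (by
      have := Finset.mem_range.1 (Finset.mem_filter.1 hk).1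
      omega)] at hmod
  rw [Int.cast_sub, Int.cast_natCast, Nat.cast_sum, hmod]
  push_cast
  ring

lemma padicNorm_natCast_eq_one_of_lt (p : ℕ) [hp : Fact p.Prime] {k : ℕ} (hk : k ≠ 0)
    (hkp : k < p) : padicNorm p k = 1 :=
  (padicNorm.nat_eq_one_iff k).2 (Nat.not_dvd_of_pos_of_lt (Nat.pos_of_ne_zero hk) hkp)

lemma padicNorm_bernoulli'_le_one (p : ℕ) [hp : Fact p.Prime] {n : ℕ} (hn : n + 1 < p) :
    padicNorm p (bernoulli' n) ≤ 1 := by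
  induction n using Nat.strong_induction_on with
  | _ n ih =>
    rw [bernoulli'_def]
    refine padicNorm.sub.trans (max_le padicNorm.one.le ?_)
    refine padicNorm.sum_le' (fun k hk => ?_) zero_le_one
    have hkn := Finset.mem_range.1 hk
    have hden : ((n : ℚ) - k + 1) = ((n - k + 1 : ℕ) : ℚ) := by
      rw [Nat.cast_add, Nat.cast_sub hkn.le, Nat.cast_one]
    rw [padicNorm.mul, padicNorm.div, hden,
      padicNorm_natCast_eq_one_of_lt p (k := n - k + 1) (by omega) (by omega)]
    rw [div_one]
    exact mul_le_one₀ (padicNorm.of_nat _) (padicNorm.nonneg _) (ih k hkn (by omega))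

lemma padicNorm_bernoulli_le_one (p : ℕ) [hp : Fact p.Prime] {n : ℕ} (hn : n + 1 < p) :
    padicNorm p (bernoulli n) ≤ 1 := by
  rw [bernoulli, padicNorm.mul]
  refine mul_le_one₀ ?_ (padicNorm.nonneg _) (padicNorm_bernoulli'_le_one p hn)
  exact_mod_cast padicNorm.of_int (p := p) ((-1) ^ n)

/-- Faulhaber's formula for `0 ^ (p - 1) + 1 ^ (p - 1)`. -/
lemma faulhaber_two_prime_sub_one (p : ℕ) [hp : Fact p.Prime] :
    (1 : ℚ) = 2 ^ p / p + (∑ k ∈ Finset.Icc 1 (p - 2),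
      bernoulli k * p.choose k * 2 ^ (p - k) / p) + 2 * bernoulli (p - 1) := by
  have hp0 : (p : ℚ) ≠ 0 := Nat.cast_ne_zero.2 hp.out.ne_zero
  have h2 := hp.out.two_le
  have h := sum_range_pow 2 (p - 1)
  obtain ⟨n, rfl⟩ : ∃ n, p = n + 2 := ⟨p - 2, by omega⟩
  simp only [show n + 2 - 1 = n + 1 by omega, show n + 2 - 2 = n by omega] at h ⊢
  rw [Finset.sum_range_succ (n := n + 1), Finset.sum_range_succ' (n := n)] at h
  have hIcc : Finset.Icc 1 n = Finset.Ico 1 (n + 1) := by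
    ext
    simp only [Finset.mem_Icc, Finset.mem_Ico]
    omega
  rw [hIcc, Finset.sum_Ico_eq_sum_range]
  simp only [Finset.sum_range_succ, Finset.sum_range_zero] at h
  simp only [Nat.add_sub_cancel, add_comm 1]
  push_cast at h hp0 ⊢
  have hd : ((n : ℚ) + 1 + 1) = n + 2 := by ring
  simp only [hd, show n + 1 + 1 = n + 2 by omega, show n + 1 - n = 1 by omega,
    Nat.choose_zero_right, bernoulli_zero, Nat.choose_succ_self_right] at h
  push_cast at h
  have hlast : bernoulli (n + 1) * ((n : ℚ) + 2) * 2 ^ 1 / (n + 2) = 2 * bernoulli (n + 1) := by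
    field_simp
  rw [hlast] at h
  simp only [zero_add, one_pow, one_mul, mul_one, ne_eq, Nat.succ_ne_zero, not_false_eq_true,
    zero_pow] at h
  linarith

lemma padicNorm_bernoulli_div_add_lt_one (p : ℕ) [hp : Fact p.Prime] {k : ℕ}
    (hk : 2 ≤ k) (hkp : k ≤ p - 2) :
    padicNorm p (bernoulli k / ((k : ℚ) * 2 ^ k) +
      bernoulli k * p.choose k * 2 ^ (p - k) / p / 2) < 1 := by
  have hp0 : (p : ℚ) ≠ 0 := Nat.cast_ne_zero.2 hp.out.ne_zero
  have hk0 : (k : ℚ) ≠ 0 := by positivity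
  rcases Nat.even_or_odd k with he | ho
  swap
  · rw [bernoulli_eq_zero_of_odd ho (by omega)]
    simp
  have hchoose : (p.choose k : ℚ) = p * (p - 1).choose (k - 1) / k := by
    rw [eq_div_iff hk0]
    have h := Nat.add_one_mul_choose_eq (p - 1) (k - 1)
    rw [Nat.sub_add_cancel hp.out.one_le, Nat.sub_add_cancel (by omega)] at h
    exact_mod_cast h.symm
  have hpow : (2 : ℚ) ^ (p - k) = 2 * 2 ^ (p - 1) / 2 ^ k := by
    rw [eq_div_iff (by positivity), ← pow_add, ← pow_succ']
    congr 1
    omega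
  have hfac : bernoulli k / ((k : ℚ) * 2 ^ k) + bernoulli k * p.choose k * 2 ^ (p - k) / p / 2 =
      bernoulli k / ((k * 2 ^ k : ℕ) : ℚ) *
        ((1 + (p - 1).choose (k - 1) * 2 ^ (p - 1) : ℕ) : ℚ) := by
    rw [hchoose, hpow]
    push_cast
    field_simp
  have h2p : (2 : ZMod p) ≠ 0 := by
    rw [show (2 : ZMod p) = ((2 : ℕ) : ZMod p) by simp, Ne, ZMod.natCast_eq_zero_iff]
    exact Nat.not_dvd_of_pos_of_lt two_pos (by omega)
  rw [hfac, padicNorm.mul, padicNorm.div]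
  have h1 : padicNorm p ((k * 2 ^ k : ℕ) : ℚ) = 1 := by
    rw [padicNorm.nat_eq_one_iff, hp.out.dvd_mul, not_or]
    refine ⟨Nat.not_dvd_of_pos_of_lt (by omega) (by omega), fun h => ?_⟩
    exact Nat.not_dvd_of_pos_of_lt two_pos (by omega) (hp.out.dvd_of_dvd_pow h)
  rw [h1, div_one]
  refine mul_lt_one_of_nonneg_of_lt_one_right (padicNorm_bernoulli_le_one p (by omega))
    (padicNorm.nonneg _) ?_
  rw [padicNorm.nat_lt_one_iff, ← ZMod.natCast_eq_zero_iff]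
  push_cast
  have hodd' : Odd (k - 1) := by
    obtain ⟨t, ht⟩ := he
    exact ⟨t - 1, by omega⟩
  rw [natCast_choose_prime_sub_one p (by omega), ZMod.pow_card_sub_one_eq_one h2p,
    hodd'.neg_one_pow]
  ring

lemma padicNorm_sum_bernoulli_lt_one (p : ℕ) [hp : Fact p.Prime] (hodd : Odd p) :
    padicNorm p ((∑ k ∈ Finset.Icc 1 (p - 2), (bernoulli k / ((k : ℚ) * 2 ^ k) +
      bernoulli k * p.choose k * 2 ^ (p - k) / p / 2)) + 1 / 2) < 1 := by
  have hp0 : (p : ℚ) ≠ 0 := Nat.cast_ne_zero.2 hp.out.ne_zero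
  have hp3 : 3 ≤ p := by
    have := hp.out.two_le
    obtain ⟨t, ht⟩ := hodd
    omega
  rw [← Finset.add_sum_Ioc_eq_sum_Icc (by omega), add_right_comm]
  refine padicNorm.nonarchimedean.trans_lt (max_lt ?_ ?_)
  · have heq : bernoulli 1 / (((1 : ℕ) : ℚ) * 2 ^ 1) +
        bernoulli 1 * p.choose 1 * 2 ^ (p - 1) / p / 2 + 1 / 2 =
        ((1 - 2 ^ (p - 1) : ℤ) : ℚ) / ((4 : ℕ) : ℚ) := by
      rw [bernoulli_one, Nat.choose_one_right]
      push_cast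
      field_simp
      ring
    have h2p : (2 : ZMod p) ≠ 0 := by
      rw [show (2 : ZMod p) = ((2 : ℕ) : ZMod p) by simp, Ne, ZMod.natCast_eq_zero_iff]
      exact Nat.not_dvd_of_pos_of_lt two_pos (by omega)
    have h4 : padicNorm p ((4 : ℕ) : ℚ) = 1 := by
      rw [padicNorm.nat_eq_one_iff, show 4 = 2 ^ 2 by norm_num]
      exact fun h => Nat.not_dvd_of_pos_of_lt two_pos (by omega) (hp.out.dvd_of_dvd_pow h)
    rw [heq, padicNorm.div, h4, div_one, padicNorm.int_lt_one_iff,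
      ← ZMod.intCast_zmod_eq_zero_iff_dvd]
    push_cast
    rw [ZMod.pow_card_sub_one_eq_one h2p, sub_self]
  · refine padicNorm.sum_lt' (fun k hk => ?_) one_pos
    rw [Finset.mem_Ioc] at hk
    exact padicNorm_bernoulli_div_add_lt_one p hk.1 hk.2

lemma padicDvd_one_of_padicNorm_lt_one (p : ℕ) [hp : Fact p.Prime] {x : ℚ}
    (h : padicNorm p x < 1) : PadicDvd p 1 x := by
  by_cases hx : x = 0
  · exact Or.inl hx
  · right
    rw [padicNorm.eq_zpow_of_nonzero hx,
      zpow_lt_one_iff_right₀ (by exact_mod_cast hp.out.one_lt)] at h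
    push_cast
    omega

theorem weighted_divided_bernoulli_sum_eq_agoh_giuga_plus_twice_even_ascent_perms
    (p : ℕ) (hp : p.Prime) (hodd : Odd p) :
    PadicDvd p 1 ((∑ k ∈ Finset.Icc 1 (p - 2), bernoulli k / ((k : ℚ) * 2 ^ k)) -
      (((p : ℚ) * bernoulli (p - 1) + 1) / p +
        2 * ((evenAscentPerms (p - 2) : ℚ) - 1))) := by
  have : Fact p.Prime := ⟨hp⟩
  have hp0 : (p : ℚ) ≠ 0 := Nat.cast_ne_zero.2 hp.ne_zero
  apply padicDvd_one_of_padicNorm_lt_one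
  have hF := faulhaber_two_prime_sub_one p
  have hpow : (2 : ℚ) ^ p = 2 * 2 ^ (p - 1) := by
    rw [← pow_succ', Nat.sub_add_cancel hp.one_le]
  have hsplit : (∑ k ∈ Finset.Icc 1 (p - 2), bernoulli k / ((k : ℚ) * 2 ^ k)) -
      (((p : ℚ) * bernoulli (p - 1) + 1) / p + 2 * ((evenAscentPerms (p - 2) : ℚ) - 1)) =
      ((∑ k ∈ Finset.Icc 1 (p - 2), (bernoulli k / ((k : ℚ) * 2 ^ k) +
        bernoulli k * p.choose k * 2 ^ (p - k) / p / 2)) + 1 / 2) +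
      (((2 : ℚ) ^ (p - 1) - 1) / p - (2 * (evenAscentPerms (p - 2) : ℚ) - 1)) := by
    rw [Finset.sum_add_distrib, ← Finset.sum_div]
    rw [hpow, mul_div_assoc] at hF
    rw [add_div, mul_div_cancel_left₀ _ hp0, sub_div]
    linarith
  rw [hsplit]
  exact padicNorm.nonarchimedean.trans_lt
    (max_lt (padicNorm_sum_bernoulli_lt_one p hodd) (padicNorm_fermatQuotient_sub_lt_one p hodd))
end

section
/- Let p be an odd prime. Then Σ_{k=1}^{p-1} (−1)^k/k ≡ 2(1 − 2·N_{p-2}) (mod p), i.e. the alternating harmonic sum up to p−1 is congruent modulo p to twice (one minus twice the number of permutations of {1,…,p−2} with an even number of ascents). -/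
/-- Prepend the value `j` to a permutation of `Fin n`, shifting the values that are at least `j`
up by one. -/
def prependPerm {n : ℕ} (x : Fin (n + 1) × Equiv.Perm (Fin n)) : Equiv.Perm (Fin (n + 1)) :=
  ((finSuccEquiv' 0).trans x.2.optionCongr).trans (finSuccEquiv' x.1).symm

@[simp]
theorem prependPerm_zero {n : ℕ} (x : Fin (n + 1) × Equiv.Perm (Fin n)) :
    prependPerm x 0 = x.1 := by
  simp [prependPerm]

@[simp]
theorem prependPerm_succ {n : ℕ} (x : Fin (n + 1) × Equiv.Perm (Fin n)) (i : Fin n) :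
    prependPerm x i.succ = x.1.succAbove (x.2 i) := by
  rw [← Fin.succAbove_zero_apply]
  simp [prependPerm, -Fin.succAbove_zero, -Fin.zero_succAbove]

theorem prependPerm_bijective (n : ℕ) :
    Function.Bijective (prependPerm : Fin (n + 1) × Equiv.Perm (Fin n) → _) := by
  rw [Fintype.bijective_iff_injective_and_card]
  refine ⟨?_, by simp [Fintype.card_perm, Nat.factorial_succ]⟩
  rintro ⟨i, σ⟩ ⟨j, τ⟩ h
  obtain rfl : i = j := by simpa using DFunLike.congr_fun h 0
  refine Prod.ext rfl (Equiv.ext fun k => ?_)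
  simpa using DFunLike.congr_fun h k.succ

theorem numAscents_prependPerm {n : ℕ} (j : Fin (n + 2)) (σ : Equiv.Perm (Fin (n + 1))) :
    numAscents (prependPerm (j, σ)) =
      (if (σ 0).castSucc < j then 0 else 1) + numAscents σ := by
  have h (i : Fin n) : (prependPerm (j, σ) i.castSucc.succ < prependPerm (j, σ) i.succ.succ) ↔
      σ i.castSucc < σ i.succ := by
    simp
  have h0 : (prependPerm (j, σ) 0 < prependPerm (j, σ) (Fin.succ 0)) ↔ ¬ (σ 0).castSucc < j := by
    rw [prependPerm_zero, prependPerm_succ, Fin.lt_succAbove_iff_le_castSucc, not_lt]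
  unfold numAscents
  rw [Finset.card_filter, Finset.card_filter]
  refine (Fin.sum_univ_succ (n := n) _).trans ?_
  congr 1
  · refine (if_congr h0 rfl rfl).trans ?_
    rw [ite_not]
  · exact Finset.sum_congr rfl fun i _ => if_congr (h i) rfl rfl

theorem sum_ite_lt_mul_pow_mul_add_one_pow {R : Type*} [CommRing R] (x : R) (n j : ℕ)
    (hj : j ≤ n + 1) :
    ∑ i ∈ Finset.range (n + 1), (if i < j then 1 else -1) * (x ^ i * (x + 1) ^ (n - i)) =
      (x + 1) ^ (n + 1) + x ^ (n + 1) - 2 * (x ^ j * (x + 1) ^ (n + 1 - j)) := by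
  induction j with
  | zero =>
    have h := (Commute.all x (x + 1)).geom_sum₂_mul (n + 1)
    simp only [Nat.add_sub_cancel, sub_add_cancel_left, mul_neg, mul_one] at h
    simp only [Nat.not_lt_zero, if_false, neg_mul, one_mul, Finset.sum_neg_distrib, h]
    simp only [pow_zero, Nat.sub_zero]
    ring
  | succ j ih =>
    have hmem : j ∈ Finset.range (n + 1) := Finset.mem_range.2 hj
    have hstep : ∑ i ∈ Finset.range (n + 1),
          (if i < j + 1 then 1 else -1) * (x ^ i * (x + 1) ^ (n - i)) =
        (∑ i ∈ Finset.range (n + 1), (if i < j then 1 else -1) * (x ^ i * (x + 1) ^ (n - i))) +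
          2 * (x ^ j * (x + 1) ^ (n - j)) := by
      rw [← Finset.add_sum_erase _ _ hmem, ← Finset.add_sum_erase _ _ hmem,
        Finset.sum_congr (g := fun i => (if i < j then 1 else -1) * (x ^ i * (x + 1) ^ (n - i))) rfl]
      · simp only [Nat.lt_succ_self, lt_self_iff_false, if_true, if_false]
        ring
      · intro i hi
        have hne := Finset.ne_of_mem_erase hi
        exact congrArg (· * _) (if_congr (by omega) rfl rfl)
    rw [hstep, ih (by omega), show n + 1 - j = (n - j) + 1 by omega,
      show n + 1 - (j + 1) = n - j by omega]
    ring

theorem sum_range_neg_one_pow_mul_add {R : Type*} [CommRing R] (f : ℕ → R) (N : ℕ) :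
    ∑ k ∈ Finset.range N, (-1) ^ k * (f (k + 1) + f k) = f 0 - (-1) ^ N * f N := by
  induction N with
  | zero => simp
  | succ N ih => rw [Finset.sum_range_succ, ih]; ring

theorem sum_range_neg_one_pow_mul_add_one_pow_add_pow {p : ℕ} (hodd : Odd p) (n : ℕ) :
    ∑ k ∈ Finset.range p, (-1) ^ k * (((k : ZMod p) + 1) ^ (n + 1) + (k : ZMod p) ^ (n + 1)) =
      0 := by
  simpa [hodd.neg_one_pow] using
    sum_range_neg_one_pow_mul_add (fun k => (k : ZMod p) ^ (n + 1)) p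

theorem sum_perm_neg_one_pow_numAscents_mul {p : ℕ} (hodd : Odd p) (n : ℕ)
    (w : Fin (n + 1) → ZMod p) :
    ∑ σ : Equiv.Perm (Fin (n + 1)), (-1) ^ numAscents σ * w (σ 0) =
      (-2) ^ n * ∑ j : Fin (n + 1), w j *
        ∑ k ∈ Finset.range p, (-1) ^ k *
          ((k : ZMod p) ^ (j : ℕ) * ((k : ZMod p) + 1) ^ (n - j)) := by
  induction n with
  | zero =>
    simp [numAscents, neg_one_geom_sum, Nat.not_even_iff_odd.2 hodd]
  | succ n ih =>
    rw [← Equiv.sum_comp (Equiv.ofBijective _ (prependPerm_bijective (n + 1))),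
      Fintype.sum_prod_type, Finset.mul_sum]
    refine Finset.sum_congr rfl fun j _ => ?_
    have hsum := ih fun i => if i.castSucc < j then 1 else -1
    have hterm (σ : Equiv.Perm (Fin (n + 1))) :
        (-1 : ZMod p) ^ numAscents (prependPerm (j, σ)) * w (prependPerm (j, σ) 0) =
          w j * ((-1) ^ numAscents σ * if (σ 0).castSucc < j then 1 else -1) := by
      rw [numAscents_prependPerm, prependPerm_zero]
      split_ifs <;> ring
    simp only [Equiv.ofBijective_apply, hterm]
    rw [← Finset.mul_sum, hsum]
    have hinner : ∑ i : Fin (n + 1), (if i.castSucc < j then 1 else -1) *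
          ∑ k ∈ Finset.range p, (-1 : ZMod p) ^ k *
            ((k : ZMod p) ^ (i : ℕ) * ((k : ZMod p) + 1) ^ (n - i)) =
        -2 * ∑ k ∈ Finset.range p, (-1 : ZMod p) ^ k *
            ((k : ZMod p) ^ (j : ℕ) * ((k : ZMod p) + 1) ^ (n + 1 - j)) := by
      simp only [Finset.mul_sum]
      rw [Finset.sum_comm, ← add_zero (∑ k ∈ Finset.range p, -2 * _),
        ← sum_range_neg_one_pow_mul_add_one_pow_add_pow hodd n, ← Finset.sum_add_distrib]
      refine Finset.sum_congr rfl fun k _ => ?_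
      have h := sum_ite_lt_mul_pow_mul_add_one_pow (k : ZMod p) n j j.is_le
      rw [← Fin.sum_univ_eq_sum_range
        (fun i => (if i < (j : ℕ) then 1 else -1) * ((k : ZMod p) ^ i * (k + 1) ^ (n - i)))] at h
      simp only [mul_left_comm _ ((-1 : ZMod p) ^ k)]
      rw [← Finset.mul_sum]
      simp only [Fin.lt_def, Fin.val_castSucc]
      rw [h]
      ring
    rw [hinner]
    ring

theorem sum_perm_neg_one_pow_numAscents {p : ℕ} (hodd : Odd p) (n : ℕ) :
    ∑ σ : Equiv.Perm (Fin (n + 1)), (-1 : ZMod p) ^ numAscents σ =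
      (-2) ^ (n + 1) * ∑ k ∈ Finset.range p, (-1) ^ k * (k : ZMod p) ^ (n + 1) := by
  have h := sum_perm_neg_one_pow_numAscents_mul hodd n fun _ => 1
  simp only [mul_one, one_mul] at h
  rw [h, pow_succ, mul_assoc, Finset.sum_comm]
  congr 1
  rw [← add_zero (-2 * _), ← sum_range_neg_one_pow_mul_add_one_pow_add_pow hodd n, Finset.mul_sum,
    ← Finset.sum_add_distrib]
  refine Finset.sum_congr rfl fun k _ => ?_
  have h := sum_ite_lt_mul_pow_mul_add_one_pow (k : ZMod p) n (n + 1) le_rfl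
  rw [← Fin.sum_univ_eq_sum_range
    (fun i => (if i < n + 1 then 1 else -1) * ((k : ZMod p) ^ i * (k + 1) ^ (n - i)))] at h
  simp only [Fin.is_lt, if_true, one_mul] at h
  rw [← Finset.mul_sum, h]
  simp only [Nat.sub_self, pow_zero]
  ring

theorem sum_perm_neg_one_pow_numAscents_eq_two_mul_evenAscentPerms_sub {R : Type*} [CommRing R]
    (n : ℕ) :
    ∑ σ : Equiv.Perm (Fin n), (-1 : R) ^ numAscents σ =
      2 * (evenAscentPerms n : R) - (n.factorial : R) := by
  have h (σ : Equiv.Perm (Fin n)) :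
      (-1 : R) ^ numAscents σ = 2 * (if Even (numAscents σ) then 1 else 0) - 1 := by
    split_ifs with hσ
    · rw [hσ.neg_one_pow]; ring
    · rw [(Nat.not_even_iff_odd.1 hσ).neg_one_pow]; ring
  simp only [h, Finset.sum_sub_distrib, ← Finset.mul_sum, Finset.sum_boole]
  simp [evenAscentPerms, Fintype.card_perm]

theorem sum_range_neg_one_pow_mul_pow_eq_two_mul {p : ℕ} [Fact p.Prime] (hodd : Odd p) :
    ∑ k ∈ Finset.range p, (-1) ^ k * (k : ZMod p) ^ (p - 2) =
      2 * (1 - 2 * (evenAscentPerms (p - 2) : ZMod p)) := by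
  have hp := Fact.out (p := p.Prime)
  obtain ⟨m, hm⟩ : ∃ m, p = m + 3 := by
    obtain ⟨r, hr⟩ := hodd
    exact ⟨p - 3, by have := hp.two_le; omega⟩
  have hsub : p - 2 = m + 1 := by omega
  have htwo : (-2 : ZMod p) ≠ 0 := by
    rw [neg_ne_zero]
    intro h
    have h2 : ((2 : ℕ) : ZMod p) = 0 := by exact_mod_cast h
    have := Nat.le_of_dvd two_pos ((ZMod.natCast_eq_zero_iff 2 p).1 h2)
    omega
  have hfermat : (-2 : ZMod p) ^ (m + 2) = 1 := by
    rw [← ZMod.pow_card_sub_one_eq_one htwo, show p - 1 = m + 2 by omega]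
  have hfact : ((m + 1).factorial : ZMod p) = 1 := by
    have hw := ZMod.wilsons_lemma p
    rw [show p - 1 = m + 1 + 1 by omega, Nat.factorial_succ, Nat.cast_mul] at hw
    have hc : ((m + 1 + 1 : ℕ) : ZMod p) = -1 := by
      rw [eq_neg_iff_add_eq_zero]
      have h0 : ((m + 3 : ℕ) : ZMod p) = 0 := by rw [← hm, ZMod.natCast_self]
      exact_mod_cast h0
    rw [hc] at hw
    linear_combination -hw
  have hA := sum_perm_neg_one_pow_numAscents hodd m
  rw [sum_perm_neg_one_pow_numAscents_eq_two_mul_evenAscentPerms_sub, hfact] at hA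
  rw [hsub]
  linear_combination
    -(∑ k ∈ Finset.range p, (-1) ^ k * (k : ZMod p) ^ (m + 1)) * hfermat + 2 * hA

theorem padicDvd_one_of_padicNorm_le {p : ℕ} [Fact p.Prime] {x : ℚ}
    (h : padicNorm p x ≤ (p : ℚ) ^ (-1 : ℤ)) : PadicDvd p 1 x := by
  by_cases hx : x = 0
  · exact Or.inl hx
  · right
    rw [padicNorm.eq_zpow_of_nonzero hx,
      zpow_le_zpow_iff_right₀ (by exact_mod_cast (Fact.out (p := p.Prime)).one_lt)] at h
    push_cast
    omega

theorem padicNorm_inv_sub_pow_le {p k : ℕ} [Fact p.Prime] (hk : 1 ≤ k) (hkp : k < p) :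
    padicNorm p ((k : ℚ)⁻¹ - (k : ℚ) ^ (p - 2)) ≤ (p : ℚ) ^ (-1 : ℤ) := by
  have hp := Fact.out (p := p.Prime)
  have hnd : ¬ p ∣ k := Nat.not_dvd_of_pos_of_lt hk hkp
  have hk0 : (k : ℚ) ≠ 0 := by positivity
  have hz : (k : ZMod p) ≠ 0 := fun h => hnd ((ZMod.natCast_eq_zero_iff k p).1 h)
  have heq : (k : ℚ)⁻¹ - (k : ℚ) ^ (p - 2) = ((1 - (k : ℤ) ^ (p - 1) : ℤ) : ℚ) / k := by
    rw [show p - 1 = p - 2 + 1 by have := hp.two_le; omega]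
    push_cast
    field_simp
    ring
  rw [heq, padicNorm.div, (padicNorm.nat_eq_one_iff k).2 hnd, div_one]
  refine (padicNorm.dvd_iff_norm_le (n := 1)).1 ?_
  rw [pow_one, ← ZMod.intCast_zmod_eq_zero_iff_dvd]
  push_cast
  rw [ZMod.pow_card_sub_one_eq_one hz, sub_self]

theorem alternating_harmonic_sum_eq_twice_one_sub_twice_even_ascent_perms
    (p : ℕ) (hp : p.Prime) (hodd : Odd p) :
    PadicDvd p 1 ((∑ k ∈ Finset.Icc 1 (p - 1), (-1 : ℚ) ^ k / k) -
      2 * (1 - 2 * (evenAscentPerms (p - 2) : ℚ))) := by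
  have : Fact p.Prime := ⟨hp⟩
  have hp3 : 3 ≤ p := by
    obtain ⟨r, hr⟩ := hodd
    have := hp.two_le
    omega
  apply padicDvd_one_of_padicNorm_le
  have hsplit : (∑ k ∈ Finset.Icc 1 (p - 1), (-1 : ℚ) ^ k / k) -
        2 * (1 - 2 * (evenAscentPerms (p - 2) : ℚ)) =
      (∑ k ∈ Finset.Icc 1 (p - 1), (-1 : ℚ) ^ k * ((k : ℚ)⁻¹ - (k : ℚ) ^ (p - 2))) +
        (((∑ k ∈ Finset.Icc 1 (p - 1), (-1 : ℤ) ^ k * (k : ℤ) ^ (p - 2)) -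
          2 * (1 - 2 * (evenAscentPerms (p - 2) : ℤ)) : ℤ) : ℚ) := by
    push_cast
    simp only [mul_sub, Finset.sum_sub_distrib, div_eq_mul_inv]
    ring
  rw [hsplit]
  refine padicNorm.nonarchimedean.trans (max_le ?_ ?_)
  · refine padicNorm.sum_le' (fun k hk => ?_) (by positivity)
    rw [Finset.mem_Icc] at hk
    have hle := padicNorm_inv_sub_pow_le hk.1 (show k < p by omega)
    rcases neg_one_pow_eq_or ℚ k with h | h <;> simpa [h, -neg_sub] using hle
  · refine (padicNorm.dvd_iff_norm_le (n := 1)).1 ?_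
    rw [pow_one, ← ZMod.intCast_zmod_eq_zero_iff_dvd]
    push_cast
    rw [← sum_range_neg_one_pow_mul_pow_eq_two_mul hodd, sub_eq_zero]
    refine Finset.sum_subset (fun k hk => ?_) (fun k hk hk' => ?_)
    · rw [Finset.mem_Icc] at hk
      exact Finset.mem_range.2 (by omega)
    · rw [Finset.mem_range] at hk
      rw [Finset.mem_Icc] at hk'
      obtain rfl : k = 0 := by omega
      simp [show p - 2 ≠ 0 by omega]
end

section
/- Let p be an odd prime. Then q_p(2) ≡ Σ_{k odd, 1 ≤ k ≤ p−1} 1/k ≡ 2(N_{p-2} − 1) + 1 (mod p): the Fermat quotient of 2 is congruent modulo p to the harmonic sum over odd reciprocals up to p−2, and both are congruent to one plus twice the number of permutations of {1,…,p−2} with an even number of ascents and distinct from the identity. -/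
open Finset

/-- The permutation of `Fin (n + 1)` sending `0` to `v` whose remaining values are in the same
relative order as those of `τ`. -/
def consPerm {n : ℕ} (v : Fin (n + 1)) (τ : Equiv.Perm (Fin n)) : Equiv.Perm (Fin (n + 1)) :=
  ((finSuccEquiv' 0).trans (Equiv.optionCongr τ)).trans (finSuccEquiv' v).symm

lemma consPerm_zero {n : ℕ} (v : Fin (n + 1)) (τ : Equiv.Perm (Fin n)) : consPerm v τ 0 = v := by
  simp [consPerm]

lemma consPerm_succ {n : ℕ} (v : Fin (n + 1)) (τ : Equiv.Perm (Fin n)) (i : Fin n) :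
    consPerm v τ i.succ = v.succAbove (τ i) := by
  have h : finSuccEquiv' (0 : Fin (n + 1)) i.succ = some i := by
    rw [← Fin.succAbove_zero, finSuccEquiv'_succAbove]
  simp [consPerm, h]

lemma consPerm_bijective (n : ℕ) :
    Function.Bijective (fun x : Fin (n + 1) × Equiv.Perm (Fin n) => consPerm x.1 x.2) := by
  rw [Fintype.bijective_iff_injective_and_card]
  refine ⟨?_, by simp [Fintype.card_perm, Nat.factorial_succ]⟩
  rintro ⟨v, τ⟩ ⟨w, ρ⟩ h
  simp only at h
  have hvw : v = w := by
    simpa [consPerm_zero] using DFunLike.congr_fun h 0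
  subst hvw
  have hτ : τ = ρ := by
    ext1 i
    simpa [consPerm_succ] using DFunLike.congr_fun h i.succ
  rw [hτ]

lemma sum_perm_eq_sum_consPerm {M : Type*} [AddCommMonoid M] (n : ℕ)
    (f : Equiv.Perm (Fin (n + 1)) → M) :
    ∑ σ, f σ = ∑ v, ∑ τ : Equiv.Perm (Fin n), f (consPerm v τ) := by
  rw [← Fintype.sum_prod_type' (fun v τ => f (consPerm v τ))]
  exact ((consPerm_bijective n).sum_comp f).symm

lemma numAscents_consPerm {n : ℕ} (v : Fin (n + 2)) (τ : Equiv.Perm (Fin (n + 1))) :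
    numAscents (consPerm v τ) = (if v ≤ (τ 0).castSucc then 1 else 0) + numAscents τ := by
  have key : ∀ (m : ℕ) (σ : Equiv.Perm (Fin (m + 1))),
      numAscents σ = ∑ i : Fin m, if σ i.castSucc < σ i.succ then 1 else 0 := by
    intro m σ
    exact Finset.card_filter _ _
  rw [key, key, Fin.sum_univ_succ]
  congr 1
  · have : (0 : Fin (n + 1)).castSucc = (0 : Fin (n + 2)) := rfl
    rw [this, consPerm_zero, consPerm_succ]
    simp only [Fin.lt_succAbove_iff_le_castSucc]
  · refine Finset.sum_congr rfl fun i _ => ?_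
    rw [← Fin.succ_castSucc, consPerm_succ, consPerm_succ]
    simp only [Fin.succAbove_lt_succAbove_iff]

/-- The signed count, by parity of ascents, of the permutations of `Fin (n + 1)` with first
value `v`. -/
def signedAscentCount (n : ℕ) (v : Fin (n + 1)) : ℤ :=
  ∑ τ : Equiv.Perm (Fin n), (-1) ^ numAscents (consPerm v τ)

lemma sum_signedAscentCount (n : ℕ) :
    ∑ v, signedAscentCount n v = ∑ σ : Equiv.Perm (Fin (n + 1)), (-1 : ℤ) ^ numAscents σ := by
  simp only [signedAscentCount, sum_perm_eq_sum_consPerm]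

lemma signedAscentCount_zero (v : Fin 1) : signedAscentCount 0 v = 1 := by
  simp [signedAscentCount, numAscents]

lemma signedAscentCount_succ (n : ℕ) (v : Fin (n + 2)) :
    signedAscentCount (n + 1) v =
      ∑ u : Fin (n + 1), (if v ≤ u.castSucc then -1 else 1) * signedAscentCount n u := by
  unfold signedAscentCount
  rw [sum_perm_eq_sum_consPerm]
  refine Finset.sum_congr rfl fun u _ => ?_
  rw [Finset.mul_sum]
  refine Finset.sum_congr rfl fun τ _ => ?_
  rw [numAscents_consPerm, consPerm_zero, pow_add]
  split_ifs <;> simp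

lemma signedAscentCount_succ_zero (n : ℕ) :
    signedAscentCount (n + 1) 0 = -∑ u, signedAscentCount n u := by
  simp [signedAscentCount_succ]

lemma signedAscentCount_succ_sub (n : ℕ) (v : Fin (n + 1)) :
    signedAscentCount (n + 1) v.succ - signedAscentCount (n + 1) v.castSucc =
      2 * signedAscentCount n v := by
  rw [signedAscentCount_succ, signedAscentCount_succ, ← Finset.sum_sub_distrib,
    Finset.sum_eq_single v]
  · simp [Fin.le_def]
    ring
  · intro u _ huv
    have : (v.succ ≤ u.castSucc) ↔ (v.castSucc ≤ u.castSucc) := by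
      have : (u : ℕ) ≠ v := fun h => huv (Fin.ext h)
      simp only [Fin.le_def, Fin.val_succ, Fin.val_castSucc]
      omega
    simp [this]
  · simp

lemma sum_pow_mul_pow_eq_sub {R : Type*} [CommRing R] (x : R) (n : ℕ) :
    ∑ u : Fin (n + 1), (x + 1) ^ (u : ℕ) * x ^ (n - u) = (x + 1) ^ (n + 1) - x ^ (n + 1) := by
  have h := (Commute.all (x + 1) x).geom_sum₂_mul (n + 1)
  rw [Fin.sum_univ_eq_sum_range (fun u => (x + 1) ^ u * x ^ (n - u)), ← h]
  simp

lemma alternating_sum_shift (p n : ℕ) :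
    ∑ k ∈ range p, (-1 : ZMod p) ^ k * ((k : ZMod p) + 1) ^ (n + 1) =
      -∑ k ∈ range p, (-1 : ZMod p) ^ k * (k : ZMod p) ^ (n + 1) := by
  have h1 := Finset.sum_range_succ (fun k : ℕ => (-1 : ZMod p) ^ k * (k : ZMod p) ^ (n + 1)) p
  have h2 := Finset.sum_range_succ' (fun k : ℕ => (-1 : ZMod p) ^ k * (k : ZMod p) ^ (n + 1)) p
  rw [h1] at h2
  simp only [CharP.cast_eq_zero, ne_eq, Nat.add_eq_zero_iff, one_ne_zero, and_false,
    not_false_eq_true, zero_pow, mul_zero, add_zero, Nat.cast_add, Nat.cast_one, Nat.cast_zero]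
    at h2
  rw [h2, ← Finset.sum_neg_distrib]
  refine Finset.sum_congr rfl fun k _ => ?_
  ring

lemma signedAscentCount_zmod {p : ℕ} (hodd : Odd p) (n : ℕ) (v : Fin (n + 1)) :
    (signedAscentCount n v : ZMod p) = 2 ^ n *
      ∑ k ∈ range p, (-1 : ZMod p) ^ k * (((k : ZMod p) + 1) ^ (v : ℕ) * (k : ZMod p) ^ (n - v)) := by
  induction n with
  | zero =>
    simp [signedAscentCount_zero, neg_one_geom_sum, Nat.not_even_iff_odd.mpr hodd]
  | succ n ih =>
    induction v using Fin.induction with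
    | zero =>
      rw [signedAscentCount_succ_zero]
      push_cast
      simp_rw [ih]
      rw [← Finset.mul_sum, Finset.sum_comm]
      simp_rw [← Finset.mul_sum, sum_pow_mul_pow_eq_sub, mul_sub]
      rw [Finset.sum_sub_distrib, alternating_sum_shift]
      simp only [Fin.val_zero, pow_zero, one_mul, Nat.sub_zero]
      ring
    | succ v ihv =>
      have h := congrArg (Int.cast : ℤ → ZMod p) (signedAscentCount_succ_sub n v)
      push_cast at h
      rw [sub_eq_iff_eq_add] at h
      rw [h, ihv, ih, pow_succ (2 : ZMod p), mul_comm _ (2 : ZMod p), mul_assoc, mul_assoc,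
        ← mul_add, ← mul_add, ← Finset.sum_add_distrib]
      congr 2
      refine Finset.sum_congr rfl fun k _ => ?_
      have hv : n + 1 - (v : ℕ) = (n - v) + 1 := by omega
      simp only [Fin.val_succ, Fin.val_castSucc, hv, Nat.add_sub_add_right]
      ring

lemma two_mul_evenAscentPerms (n : ℕ) :
    (2 * evenAscentPerms n : ℤ) =
      n.factorial + ∑ σ : Equiv.Perm (Fin n), (-1 : ℤ) ^ numAscents σ := by
  have h : (n.factorial : ℤ) = ∑ _σ : Equiv.Perm (Fin n), 1 := by
    simp [Fintype.card_perm]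
  rw [h, ← Finset.sum_add_distrib, evenAscentPerms, Finset.card_filter]
  push_cast
  rw [Finset.mul_sum]
  refine Finset.sum_congr rfl fun σ _ => ?_
  split_ifs with he
  · simp [he.neg_one_pow]
  · simp [(Nat.not_even_iff_odd.mp he).neg_one_pow]

lemma two_ne_zero_zmod {p : ℕ} [Fact p.Prime] (hodd : Odd p) : (2 : ZMod p) ≠ 0 := by
  have hp := (Fact.out : p.Prime)
  intro h
  have h' : ((2 : ℕ) : ZMod p) = 0 := by exact_mod_cast h
  rw [ZMod.natCast_eq_zero_iff] at h'
  rw [(Nat.prime_dvd_prime_iff_eq hp Nat.prime_two).mp h'] at hodd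
  exact absurd hodd (by decide)

lemma sum_inv_range_eq_zero {p : ℕ} [Fact p.Prime] (hodd : Odd p) :
    ∑ k ∈ range p, (k : ZMod p)⁻¹ = 0 := by
  have hp := (Fact.out : p.Prime)
  have h2 := two_ne_zero_zmod hodd
  obtain ⟨m, rfl⟩ : ∃ m, p = m + 1 := ⟨p - 1, by have := hp.pos; omega⟩
  rw [Finset.sum_range_succ']
  simp only [Nat.cast_zero, inv_zero, add_zero]
  have h := Finset.sum_range_reflect (fun k : ℕ => ((k + 1 : ℕ) : ZMod (m + 1))⁻¹) m
  have h' : ∑ k ∈ range m, ((m - 1 - k + 1 : ℕ) : ZMod (m + 1))⁻¹ =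
      -∑ k ∈ range m, ((k + 1 : ℕ) : ZMod (m + 1))⁻¹ := by
    rw [← Finset.sum_neg_distrib]
    refine Finset.sum_congr rfl fun k hk => ?_
    rw [← inv_neg]
    congr 1
    rw [eq_neg_iff_add_eq_zero, ← Nat.cast_add, ZMod.natCast_eq_zero_iff]
    have := Finset.mem_range.mp hk
    exact ⟨1, by omega⟩
  rw [h'] at h
  have h3 : (2 : ZMod (m + 1)) * ∑ k ∈ range m, ((k + 1 : ℕ) : ZMod (m + 1))⁻¹ = 0 := by
    linear_combination -h
  exact (mul_eq_zero.mp h3).resolve_left h2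

lemma alternating_sum_inv {p : ℕ} [Fact p.Prime] (hodd : Odd p) :
    ∑ k ∈ range p, (-1 : ZMod p) ^ k * (k : ZMod p)⁻¹ =
      -2 * ∑ k ∈ (Icc 1 (p - 1)).filter (fun k => Odd k), (k : ZMod p)⁻¹ := by
  have hs : (Icc 1 (p - 1)).filter (fun k => Odd k) = (range p).filter (fun k => Odd k) := by
    ext k
    simp only [mem_filter, mem_Icc, mem_range]
    constructor
    · rintro ⟨h, ho⟩
      exact ⟨by omega, ho⟩
    · rintro ⟨h, ho⟩
      have := ho.pos
      exact ⟨by omega, ho⟩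
  rw [hs, Finset.sum_filter, Finset.mul_sum]
  refine (sub_eq_self.mpr (sum_inv_range_eq_zero hodd)).symm.trans ?_
  rw [← Finset.sum_sub_distrib]
  refine Finset.sum_congr rfl fun k _ => ?_
  split_ifs with ho
  · rw [ho.neg_one_pow]
    ring
  · rw [(Nat.not_odd_iff_even.mp ho).neg_one_pow]
    ring

lemma choose_pred_prime_zmod {p : ℕ} [Fact p.Prime] (j : ℕ) (hj : j < p) :
    ((p - 1).choose j : ZMod p) = (-1) ^ j := by
  have hp := (Fact.out : p.Prime)
  induction j with
  | zero => simp
  | succ j ih =>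
    have h := Nat.choose_succ_succ (p - 1) j
    rw [show (p - 1).succ = p by have := hp.pos; omega] at h
    have h0 : ((p.choose (j + 1) : ℕ) : ZMod p) = 0 := by
      rw [ZMod.natCast_eq_zero_iff]
      exact hp.dvd_choose_self (by omega) hj
    have h1 := congrArg (Nat.cast : ℕ → ZMod p) h
    push_cast at h1
    rw [show j.succ = j + 1 from rfl, h0, ih (by omega)] at h1
    rw [pow_succ]
    linear_combination -h1

lemma two_mul_fermatQuotient_zmod {p : ℕ} [Fact p.Prime] (hodd : Odd p) {q : ℤ}
    (hq : (2 : ℤ) ^ (p - 1) - 1 = p * q) :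
    (2 * q : ZMod p) = -∑ k ∈ range p, (-1 : ZMod p) ^ k * (k : ZMod p)⁻¹ := by
  have hp := (Fact.out : p.Prime)
  obtain ⟨m, rfl⟩ : ∃ m, p = m + 1 := ⟨p - 1, by have := hp.pos; omega⟩
  have hc : ∀ k ∈ range m, ((m + 1).choose (k + 1) : ℤ) =
      (m + 1 : ℕ) * ((m + 1).choose (k + 1) / (m + 1) : ℕ) := by
    intro k hk
    have hk := Finset.mem_range.mp hk
    have := Nat.mul_div_cancel' (hp.dvd_choose_self (k := k + 1) (by omega) (by omega))
    exact_mod_cast this.symm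
  have hsum : (2 * q : ℤ) = ∑ k ∈ range m, (((m + 1).choose (k + 1) / (m + 1) : ℕ) : ℤ) := by
    have hne : ((m + 1 : ℕ) : ℤ) ≠ 0 := by positivity
    apply mul_left_cancel₀ hne
    rw [Finset.mul_sum, ← Finset.sum_congr rfl hc]
    have h := Nat.sum_range_choose (m + 1)
    rw [Finset.sum_range_succ, Finset.sum_range_succ'] at h
    have h' := congrArg (Nat.cast : ℕ → ℤ) h
    push_cast [Nat.choose_self, Nat.choose_zero_right] at h'
    simp only [Nat.add_sub_cancel] at hq
    rw [pow_succ] at h'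
    push_cast at hq ⊢
    linear_combination -h' - 2 * hq
  have hz := congrArg (Int.cast : ℤ → ZMod (m + 1)) hsum
  simp only [Int.cast_mul, Int.cast_ofNat, Int.cast_sum, Int.cast_natCast] at hz
  rw [hz, Finset.sum_range_succ']
  simp only [Nat.cast_zero, inv_zero, mul_zero, add_zero]
  rw [← Finset.sum_neg_distrib]
  refine Finset.sum_congr rfl fun k hk => ?_
  have hk' := Finset.mem_range.mp hk
  have hk0 : ((k + 1 : ℕ) : ZMod (m + 1)) ≠ 0 := by
    rw [Ne, ZMod.natCast_eq_zero_iff]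
    exact Nat.not_dvd_of_pos_of_lt (by omega) (by omega)
  have hmul : (m + 1).choose (k + 1) / (m + 1) * (k + 1) = m.choose k := by
    have h1 := Nat.add_one_mul_choose_eq m k
    have h2 := Nat.mul_div_cancel' (hp.dvd_choose_self (k := k + 1) (by omega) (by omega))
    apply Nat.eq_of_mul_eq_mul_left hp.pos
    rw [h1, ← mul_assoc, h2]
  have hmul' := congrArg (Nat.cast : ℕ → ZMod (m + 1)) hmul
  have hch := choose_pred_prime_zmod (p := m + 1) k (by omega)
  rw [Nat.add_sub_cancel] at hch
  rw [hch, Nat.cast_mul] at hmul'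
  rw [(eq_mul_inv_iff_mul_eq₀ hk0).mpr hmul', pow_succ]
  ring

lemma factorial_prime_sub_two_zmod {p : ℕ} [Fact p.Prime] :
    ((p - 2).factorial : ZMod p) = 1 := by
  have hp := (Fact.out : p.Prime)
  have h := ZMod.wilsons_lemma p
  have h2 := hp.two_le
  rw [show p - 1 = (p - 2) + 1 by omega, Nat.factorial_succ, show p - 2 + 1 = p - 1 by omega,
    Nat.cast_mul, Nat.cast_sub (by omega)] at h
  simp only [CharP.cast_eq_zero, Nat.cast_one, zero_sub, neg_mul, one_mul, neg_inj] at h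
  exact h

lemma two_mul_evenAscentPerms_zmod {p : ℕ} [Fact p.Prime] (hodd : Odd p) :
    (2 * evenAscentPerms (p - 2) : ZMod p) =
      1 + ∑ k ∈ (Icc 1 (p - 1)).filter (fun k => Odd k), (k : ZMod p)⁻¹ := by
  have hp := (Fact.out : p.Prime)
  have h3 : 3 ≤ p := by
    have := hp.two_le
    obtain ⟨r, hr⟩ := hodd
    omega
  obtain ⟨m, hm⟩ : ∃ m, p = m + 3 := ⟨p - 3, by omega⟩
  have hm2 : p - 2 = m + 1 := by omega
  have h := two_mul_evenAscentPerms (p - 2)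
  have hs : ∑ σ : Equiv.Perm (Fin (p - 2)), (-1 : ℤ) ^ numAscents σ =
      -signedAscentCount (m + 1) 0 := by
    rw [hm2, signedAscentCount_succ_zero, sum_signedAscentCount, neg_neg]
  rw [hs] at h
  have hz := congrArg (Int.cast : ℤ → ZMod p) h
  push_cast at hz
  rw [hz, factorial_prime_sub_two_zmod, signedAscentCount_zmod hodd]
  have hinv : ∀ k ∈ range p, (-1 : ZMod p) ^ k * (((k : ZMod p) + 1) ^ ((0 : Fin (m + 2)) : ℕ) *
      (k : ZMod p) ^ (m + 1 - ((0 : Fin (m + 2)) : ℕ))) = (-1 : ZMod p) ^ k * (k : ZMod p)⁻¹ := by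
    intro k _
    simp only [Fin.val_zero, pow_zero, one_mul, Nat.sub_zero]
    congr 1
    by_cases hk : (k : ZMod p) = 0
    · simp [hk]
    · apply eq_inv_of_mul_eq_one_left
      rw [← pow_succ, show m + 1 + 1 = p - 1 by omega]
      exact ZMod.pow_card_sub_one_eq_one hk
  rw [Finset.sum_congr rfl hinv, alternating_sum_inv hodd]
  have h2 := two_ne_zero_zmod hodd
  have hf := ZMod.pow_card_sub_one_eq_one h2
  rw [show p - 1 = m + 1 + 1 by omega, pow_succ] at hf
  rw [show p - 1 = m + 1 + 1 by omega]
  linear_combination (∑ k ∈ (Icc 1 (m + 1 + 1)).filter (fun k => Odd k), (k : ZMod p)⁻¹) * hf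

lemma padicDvd_one_of_mul_eq {p : ℕ} [Fact p.Prime] {x : ℚ} {d : ℕ} {z : ℤ}
    (hd : ¬ p ∣ d) (hx : x * d = z) (hz : (z : ZMod p) = 0) : PadicDvd p 1 x := by
  by_cases h0 : x = 0
  · exact Or.inl h0
  right
  have hd0 : d ≠ 0 := by
    rintro rfl
    exact hd (dvd_zero p)
  have hdq : (d : ℚ) ≠ 0 := by exact_mod_cast hd0
  have hz0 : z ≠ 0 := by
    rintro rfl
    rw [Int.cast_zero] at hx
    exact mul_ne_zero h0 hdq hx
  have hval : padicValRat p x + padicValRat p (d : ℚ) = padicValRat p (z : ℚ) := by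
    rw [← padicValRat.mul h0 hdq, hx]
  rw [padicValRat.of_nat, padicValRat.of_int, padicValNat.eq_zero_of_not_dvd hd] at hval
  have hdvd : (p : ℤ) ∣ z := (ZMod.intCast_zmod_eq_zero_iff_dvd z p).mp hz
  have h1 : 1 ≤ padicValInt p z := by
    have := (padicValInt_dvd_iff (p := p) 1 z).mp (by simpa using hdvd)
    exact this.resolve_left hz0
  push_cast at hval ⊢
  omega

lemma exists_int_oddHarmonic {p : ℕ} [Fact p.Prime] :
    ∃ z : ℤ, (∑ k ∈ (Icc 1 (p - 1)).filter (fun k => Odd k), (1 : ℚ) / k) * (p - 1).factorial = z ∧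
      (z : ZMod p) = (∑ k ∈ (Icc 1 (p - 1)).filter (fun k => Odd k), (k : ZMod p)⁻¹) *
        (p - 1).factorial := by
  refine ⟨∑ k ∈ (Icc 1 (p - 1)).filter (fun k => Odd k), (((p - 1).factorial / k : ℕ) : ℤ), ?_, ?_⟩
  · simp only [Int.cast_sum, Int.cast_natCast]
    rw [Finset.sum_mul]
    refine Finset.sum_congr rfl fun k hk => ?_
    simp only [mem_filter, mem_Icc] at hk
    have hk0 : (k : ℚ) ≠ 0 := by
      have : k ≠ 0 := by omega
      exact_mod_cast this
    rw [Nat.cast_div (Nat.dvd_factorial (by omega) hk.1.2) hk0]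
    ring
  · simp only [Int.cast_sum, Int.cast_natCast]
    rw [Finset.sum_mul]
    refine Finset.sum_congr rfl fun k hk => ?_
    simp only [mem_filter, mem_Icc] at hk
    have hk0 : (k : ZMod p) ≠ 0 := by
      rw [Ne, ZMod.natCast_eq_zero_iff]
      exact Nat.not_dvd_of_pos_of_lt (by omega) (by omega)
    have h := congrArg (Nat.cast : ℕ → ZMod p)
      (Nat.mul_div_cancel' (Nat.dvd_factorial (m := k) (n := p - 1) (by omega) hk.1.2))
    rw [Nat.cast_mul] at h
    rw [← h, inv_mul_cancel_left₀ hk0]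

theorem fermat_quotient_eq_odd_harmonic_sum_eq_twice_even_ascent_perms_plus_one
    (p : ℕ) (hp : p.Prime) (hodd : Odd p) :
    PadicDvd p 1 ((((2 : ℚ) ^ (p - 1) - 1) / p) -
      ∑ k ∈ (Finset.Icc 1 (p - 1)).filter (fun k => Odd k), (1 : ℚ) / k) ∧
    PadicDvd p 1 ((∑ k ∈ (Finset.Icc 1 (p - 1)).filter (fun k => Odd k), (1 : ℚ) / k) -
      (2 * ((evenAscentPerms (p - 2) : ℚ) - 1) + 1)) := by
  have : Fact p.Prime := ⟨hp⟩
  have h2 := two_ne_zero_zmod hodd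
  have hd : ¬ p ∣ (p - 1).factorial := by
    rw [hp.dvd_factorial]
    have := hp.pos
    omega
  obtain ⟨z, hzq, hzp⟩ := exists_int_oddHarmonic (p := p)
  constructor
  · obtain ⟨q, hq⟩ : (p : ℤ) ∣ 2 ^ (p - 1) - 1 := by
      rw [← ZMod.intCast_zmod_eq_zero_iff_dvd]
      push_cast
      rw [ZMod.pow_card_sub_one_eq_one h2, sub_self]
    have hqq : ((2 : ℚ) ^ (p - 1) - 1) / p = q := by
      have hp0 : (p : ℚ) ≠ 0 := by exact_mod_cast hp.ne_zero
      rw [div_eq_iff hp0, mul_comm]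
      exact_mod_cast hq
    have hq2 := two_mul_fermatQuotient_zmod hodd hq
    rw [alternating_sum_inv hodd, neg_mul, neg_neg] at hq2
    have hqz := mul_left_cancel₀ h2 hq2
    refine padicDvd_one_of_mul_eq (z := q * (p - 1).factorial - z) hd ?_ ?_
    · rw [hqq, sub_mul, hzq]
      push_cast
      ring
    · push_cast
      rw [hzp, hqz, sub_self]
  · have hN := two_mul_evenAscentPerms_zmod hodd
    refine padicDvd_one_of_mul_eq
      (z := z - (2 * ((evenAscentPerms (p - 2) : ℤ) - 1) + 1) * (p - 1).factorial) hd ?_ ?_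
    · rw [sub_mul, hzq]
      push_cast
      ring
    · push_cast
      rw [hzp]
      linear_combination -((p - 1).factorial : ZMod p) * hN
end

section
/- Let p be an odd prime and set 𝓑_0 = −1/p and 𝓑_k = B_k/k for k ≥ 1. Then Σ_{k=0}^{p-1} 𝓑_k/2^k ≡ 0 (mod p), i.e. the p-adic valuation of −1/p + Σ_{k=1}^{p-1} B_k/(k·2^k) is at least 1. -/
/-- The subring of `p`-integral rational numbers. -/
def pIntegralSubring (p : ℕ) [Fact p.Prime] : Subring ℚ where
  carrier := {x | padicNorm p x ≤ 1}
  mul_mem' {x y} hx hy := by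
    simp only [Set.mem_ofPred_eq] at *
    rw [padicNorm.mul]
    exact mul_le_one₀ hx (padicNorm.nonneg _) hy
  one_mem' := by simp
  add_mem' hx hy := padicNorm.nonarchimedean.trans (max_le hx hy)
  zero_mem' := by simp
  neg_mem' {x} hx := by simpa using hx

theorem inv_mem_pIntegralSubring {p n : ℕ} [Fact p.Prime] (h : ¬ p ∣ n) :
    ((n : ℚ))⁻¹ ∈ pIntegralSubring p := by
  change padicNorm p _ ≤ 1
  have h1 : padicNorm p (n : ℚ) = 1 := (padicNorm.nat_eq_one_iff n).mpr h
  have h2 := padicNorm.mul (p := p) (n : ℚ) ((n : ℚ))⁻¹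
  have h0 : (n : ℚ) ≠ 0 := by
    rintro h'
    simp [h'] at h1
  rw [mul_inv_cancel₀ h0, h1, one_mul] at h2
  simp [← h2]

theorem padicDvd_one_of_div_mem {p : ℕ} [Fact p.Prime] {x : ℚ}
    (h : x / p ∈ pIntegralSubring p) : PadicDvd p 1 x := by
  have hp : (p : ℚ) ≠ 0 := mod_cast (Fact.out : p.Prime).ne_zero
  rcases eq_or_ne x 0 with h0 | h0
  · exact Or.inl h0
  right
  change padicNorm p _ ≤ 1 at h
  rw [padicNorm.eq_zpow_of_nonzero (div_ne_zero h0 hp),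
    padicValRat.div h0 hp, padicValRat.self (Fact.out : p.Prime).one_lt] at h
  have h1 : (1 : ℚ) < p := mod_cast (Fact.out : p.Prime).one_lt
  rw [zpow_le_one_iff_right₀ h1] at h
  push_cast
  linarith

theorem bernoulli_mem_pIntegralSubring {p k : ℕ} [Fact p.Prime] (hk : k + 1 < p) :
    bernoulli k ∈ pIntegralSubring p := by
  induction k using Nat.strong_induction_on with
  | _ k ih =>
    rcases Nat.eq_zero_or_pos k with rfl | hpos
    · simp
    have h := sum_bernoulli (k + 1)
    rw [Finset.sum_range_succ, if_neg (by omega), Nat.choose_succ_self_right] at h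
    have h0 : ((k + 1 : ℕ) : ℚ) ≠ 0 := by positivity
    have h2 : bernoulli k = -(∑ i ∈ Finset.range k, ((k + 1).choose i : ℚ) * bernoulli i) *
        ((k + 1 : ℕ) : ℚ)⁻¹ := by
      rw [eq_mul_inv_iff_mul_eq₀ h0]
      linarith
    rw [h2]
    refine mul_mem (neg_mem (sum_mem fun i hi => mul_mem (natCast_mem _ _) ?_))
      (inv_mem_pIntegralSubring (Nat.not_dvd_of_pos_of_lt (by omega) hk))
    have := Finset.mem_range.mp hi
    exact ih i this (by omega)

/-- `p * B_{p-1} ≡ -1` modulo `p`. -/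
theorem exists_prime_mul_bernoulli_eq {p : ℕ} [Fact p.Prime] :
    ∃ t ∈ pIntegralSubring p, (p : ℚ) * bernoulli (p - 1) = -1 + p * t := by
  have hp : p.Prime := Fact.out
  obtain ⟨n, rfl⟩ : ∃ n, p = n + 2 := ⟨p - 2, by have := hp.two_le; omega⟩
  have h := sum_bernoulli (n + 2)
  rw [Finset.sum_range_succ, if_neg (by omega), Nat.choose_succ_self_right,
    Finset.sum_range_succ'] at h
  have hp0 : ((n + 2 : ℕ) : ℚ) ≠ 0 := by positivity
  refine ⟨-((∑ i ∈ Finset.range n, ((n + 2).choose (i + 1) : ℚ) * bernoulli (i + 1)) /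
    ((n + 2 : ℕ) : ℚ)), ?_, ?_⟩
  · rw [Finset.sum_div]
    refine neg_mem (sum_mem fun i hi => ?_)
    have hi := Finset.mem_range.mp hi
    obtain ⟨c, hc⟩ := hp.dvd_choose_self (k := i + 1) (by omega) (by omega)
    rw [hc, Nat.cast_mul, mul_assoc, mul_div_cancel_left₀ _ hp0]
    exact mul_mem (natCast_mem _ _) (bernoulli_mem_pIntegralSubring (by omega))
  · rw [mul_neg, mul_div_cancel₀ _ hp0]
    simp only [Nat.choose_zero_right, bernoulli_zero] at h
    change ((n + 1 + 1 : ℕ) : ℚ) * bernoulli (n + 1) = _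
    push_cast at h ⊢
    linarith

theorem prime_dvd_choose_sub_neg_one_pow {p j : ℕ} (hp : p.Prime) (hj : j < p) :
    (p : ℤ) ∣ ((p - 1).choose j : ℤ) - (-1) ^ j := by
  induction j with
  | zero => simp
  | succ j ih =>
    have h : (p - 1).choose j + (p - 1).choose (j + 1) = p.choose (j + 1) := by
      obtain ⟨n, rfl⟩ : ∃ n, p = n + 1 := ⟨p - 1, by omega⟩
      exact (Nat.choose_succ_succ n j).symm
    have hd : (p : ℤ) ∣ (p.choose (j + 1) : ℕ) :=
      Int.natCast_dvd_natCast.mpr (hp.dvd_choose_self (by omega) hj)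
    rw [← h] at hd
    have := dvd_sub hd (ih (by omega))
    have heq : ((p - 1).choose (j + 1) : ℤ) - (-1) ^ (j + 1) =
        (((p - 1).choose j + (p - 1).choose (j + 1) : ℕ) : ℤ) -
          (((p - 1).choose j : ℤ) - (-1) ^ j) := by
      push_cast
      ring
    rwa [heq]

/-- The expansion of the Bernoulli polynomial identity `B_n(2) = B_n + n`. -/
theorem sum_choose_mul_bernoulli_div_two_pow {n : ℕ} (hn : 1 < n) :
    1 / (n : ℚ) + ∑ k ∈ Finset.Icc 1 (n - 1),
      ((n - 1).choose (k - 1) : ℚ) * (bernoulli k / ((k : ℚ) * 2 ^ k)) = 1 / 2 ^ n := by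
  obtain ⟨m, rfl⟩ : ∃ m, n = m + 1 := ⟨n - 1, by omega⟩
  have h := sum_range_pow 2 m
  have hm : (m : ℚ) + 1 ≠ 0 := by positivity
  rw [Finset.sum_range_succ' _ m] at h
  simp only [Finset.sum_range_succ _ 1, Finset.sum_range_succ _ 0, Finset.sum_range_zero] at h
  have h2 : ∀ i ∈ Finset.range m, bernoulli (i + 1) * ((m + 1).choose (i + 1) : ℚ) *
      ((2 : ℕ) : ℚ) ^ (m + 1 - (i + 1)) / (m + 1) =
      2 ^ (m + 1) * ((m.choose i : ℚ) * (bernoulli (i + 1) / (((i + 1 : ℕ) : ℚ) * 2 ^ (i + 1)))) := by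
    intro i hi
    have hi := Finset.mem_range.mp hi
    have hc : ((m + 1 : ℕ) : ℚ) * (m.choose i) = (m + 1).choose (i + 1) * ((i + 1 : ℕ) : ℚ) :=
      mod_cast Nat.add_one_mul_choose_eq m i
    have hpow : (2 : ℚ) ^ (m + 1) = 2 ^ (m + 1 - (i + 1)) * 2 ^ (i + 1) := by
      rw [← pow_add]; congr 1; omega
    rw [hpow]
    have hi0 : ((i + 1 : ℕ) : ℚ) ≠ 0 := by positivity
    push_cast at hc hi0 ⊢
    generalize (2 : ℚ) ^ (m + 1 - (i + 1)) = a
    field_simp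
    linear_combination (-bernoulli (i + 1)) * hc
  rw [Finset.sum_congr rfl h2, ← Finset.mul_sum] at h
  have h3 : ∑ k ∈ Finset.Icc 1 (m + 1 - 1),
      ((m + 1 - 1).choose (k - 1) : ℚ) * (bernoulli k / ((k : ℚ) * 2 ^ k)) =
      ∑ i ∈ Finset.range m,
        ((m.choose i : ℚ) * (bernoulli (i + 1) / (((i + 1 : ℕ) : ℚ) * 2 ^ (i + 1)))) := by
    rw [Finset.range_eq_Ico]
    exact (Finset.sum_Ico_add' (fun k => ((m.choose (k - 1) : ℚ) *
      (bernoulli k / ((k : ℚ) * 2 ^ k)))) 0 m 1).symm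
  rw [h3]
  have hm0 : m ≠ 0 := by omega
  simp only [Nat.cast_zero, zero_pow hm0, Nat.cast_one, one_pow, bernoulli_zero,
    Nat.choose_zero_right, Nat.sub_zero, zero_add, one_mul, mul_one, Nat.cast_ofNat] at h
  push_cast at h ⊢
  field_simp at h ⊢
  linear_combination -h

theorem one_add_choose_mul_bernoulli_div_mem {p k : ℕ} [Fact p.Prime]
    (hk : 2 ≤ k) (hkp : k + 1 < p) :
    (1 + ((p - 1).choose (k - 1) : ℚ)) * (bernoulli k / ((k : ℚ) * 2 ^ k)) / p ∈
      pIntegralSubring p := by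
  have hp : p.Prime := Fact.out
  have hp0 : (p : ℚ) ≠ 0 := mod_cast hp.ne_zero
  rcases Nat.even_or_odd k with he | ho
  · obtain ⟨c, hc⟩ := prime_dvd_choose_sub_neg_one_pow hp (j := k - 1) (by omega)
    rw [(Nat.Even.sub_odd (by omega) he odd_one).neg_one_pow] at hc
    have hc' : 1 + ((p - 1).choose (k - 1) : ℚ) = p * c := by
      have : (((p - 1).choose (k - 1) : ℤ) : ℚ) - (-1) = p * c := by exact_mod_cast hc
      push_cast at this
      linarith
    rw [hc', mul_assoc, mul_div_cancel_left₀ _ hp0, div_eq_mul_inv, mul_inv, ← inv_pow]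
    have h2 : ((2 : ℕ) : ℚ)⁻¹ ∈ pIntegralSubring p :=
      inv_mem_pIntegralSubring (Nat.not_dvd_of_pos_of_lt (by omega) (by omega))
    exact mul_mem (intCast_mem _ _) (mul_mem (bernoulli_mem_pIntegralSubring hkp)
      (mul_mem (inv_mem_pIntegralSubring (Nat.not_dvd_of_pos_of_lt (by omega) (by omega)))
        (pow_mem h2 _)))
  · rw [bernoulli_eq_zero_of_odd ho (by omega)]
    simp

theorem weighted_divided_bernoulli_sum_with_convention_eq_zero
    (p : ℕ) (hp : p.Prime) (hodd : Odd p) :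
    PadicDvd p 1 (-(1 / (p : ℚ)) +
      ∑ k ∈ Finset.Icc 1 (p - 1), bernoulli k / ((k : ℚ) * 2 ^ k)) := by
  have : Fact p.Prime := ⟨hp⟩
  apply padicDvd_one_of_div_mem
  have hp3 : 3 ≤ p := by
    have := hp.two_le
    rcases hodd with ⟨r, hr⟩
    omega
  have key := sum_choose_mul_bernoulli_div_two_pow hp.one_lt
  have hsum : -(1 / (p : ℚ)) + ∑ k ∈ Finset.Icc 1 (p - 1), bernoulli k / ((k : ℚ) * 2 ^ k) =
      ∑ k ∈ Finset.Icc 1 (p - 1),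
        (1 + ((p - 1).choose (k - 1) : ℚ)) * (bernoulli k / ((k : ℚ) * 2 ^ k)) - 1 / 2 ^ p := by
    simp only [add_mul, one_mul, Finset.sum_add_distrib]
    linarith
  rw [hsum]
  obtain ⟨t, ht, hB⟩ := exists_prime_mul_bernoulli_eq (p := p)
  have hmid : (∑ k ∈ Finset.Ico 2 (p - 1),
      (1 + ((p - 1).choose (k - 1) : ℚ)) * (bernoulli k / ((k : ℚ) * 2 ^ k))) / p ∈
        pIntegralSubring p := by
    rw [Finset.sum_div]
    refine sum_mem fun k hk => ?_
    have := Finset.mem_Ico.mp hk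
    exact one_add_choose_mul_bernoulli_div_mem this.1 (by omega)
  have h2 : ¬ p ∣ 2 := Nat.not_dvd_of_pos_of_lt (by omega) (by omega)
  obtain ⟨m, hm⟩ : (p : ℤ) ∣ 2 ^ (p - 1) - 1 :=
    (Int.ModEq.pow_card_sub_one_eq_one hp
      (by exact_mod_cast ((Nat.Prime.coprime_iff_not_dvd hp).mpr h2).symm)).symm.dvd
  have hm' : (2 : ℚ) ^ (p - 1) - 1 = p * m := by exact_mod_cast hm
  have hinv2 : ((2 : ℕ) : ℚ)⁻¹ ∈ pIntegralSubring p := inv_mem_pIntegralSubring h2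
  have hinvp : ((p - 1 : ℕ) : ℚ)⁻¹ ∈ pIntegralSubring p :=
    inv_mem_pIntegralSubring (Nat.not_dvd_of_pos_of_lt (by omega) (by omega))
  have hsplit : Finset.Icc 1 (p - 1) = insert 1 (insert (p - 1) (Finset.Ico 2 (p - 1))) := by
    ext k
    simp only [Finset.mem_Icc, Finset.mem_insert, Finset.mem_Ico]
    omega
  rw [hsplit, Finset.sum_insert (by simp; omega), Finset.sum_insert (by simp)]
  generalize (∑ k ∈ Finset.Ico 2 (p - 1),
      (1 + ((p - 1).choose (k - 1) : ℚ)) * (bernoulli k / ((k : ℚ) * 2 ^ k))) = M at hmid ⊢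
  have hlast : (p - 1).choose (p - 1 - 1) = p - 1 := by
    obtain ⟨n, rfl⟩ : ∃ n, p = n + 2 := ⟨p - 2, by omega⟩
    exact Nat.choose_succ_self_right n
  have hpow : (2 : ℚ) ^ p = 2 * 2 ^ (p - 1) := by
    rw [← pow_succ']; congr 1; omega
  have hcast : ((p - 1 : ℕ) : ℚ) = p - 1 := by
    rw [Nat.cast_sub (by omega)]; simp
  have hp0 : (p : ℚ) ≠ 0 := mod_cast hp.ne_zero
  have hp1 : (p : ℚ) - 1 ≠ 0 := by
    rw [← hcast]; exact_mod_cast (by omega : p - 1 ≠ 0)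
  have hq0 : (2 : ℚ) ^ (p - 1) ≠ 0 := by positivity
  have hqinv : ((2 : ℚ) ^ (p - 1))⁻¹ ∈ pIntegralSubring p := by
    rw [← inv_pow]; exact pow_mem hinv2 _
  rw [hlast, hpow, hcast]
  rw [hcast] at hinvp
  generalize (2 : ℚ) ^ (p - 1) = q at *
  have hfinal : ((1 + (((p - 1).choose (1 - 1) : ℕ) : ℚ)) * (bernoulli 1 / (((1 : ℕ) : ℚ) * 2 ^ 1)) +
      ((1 + ((p : ℚ) - 1)) * (bernoulli (p - 1) / (((p : ℚ) - 1) * q)) + M) - 1 / (2 * q)) / p =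
      M / p + (((p : ℚ) - 1)⁻¹ * q⁻¹ * t -
        (2 + m * ((p : ℚ) - 1)) * (((2 : ℕ) : ℚ)⁻¹ * ((p : ℚ) - 1)⁻¹ * q⁻¹)) := by
    have hb : bernoulli (p - 1) = (-1 + p * t) / p := by
      rw [← hB, mul_div_cancel_left₀ _ hp0]
    have hq : q = 1 + p * m := by linarith
    rw [hb]
    simp only [Nat.sub_self, Nat.choose_zero_right, bernoulli_one, Nat.cast_one, Nat.cast_ofNat]
    field_simp
    rw [hq]
    ring
  rw [hfinal]
  have hpmem : (p : ℚ) - 1 ∈ pIntegralSubring p := sub_mem (natCast_mem _ _) (one_mem _)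
  have h2mem : (2 : ℚ) ∈ pIntegralSubring p := by exact_mod_cast natCast_mem (pIntegralSubring p) 2
  exact add_mem hmid (sub_mem (mul_mem (mul_mem hinvp hqinv) ht)
    (mul_mem (add_mem h2mem (mul_mem (intCast_mem _ _) hpmem))
      (mul_mem (mul_mem hinv2 hinvp) hqinv)))
end

section
/- Let p be an odd prime. Then Σ_{k=1}^{p-2} B_k/k ≡ (p·B_{p-1} + 1)/p − 1 ≡ w_p (mod p): the sum of the first p−2 divided Bernoulli numbers is congruent modulo p to the Agoh–Giuga quotient minus 1, which equals the Wilson quotient modulo p. -/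
/-- The subring of `ℚ` of rational numbers that are integral at `p`. -/
noncomputable def padicIntegral (p : ℕ) [Fact p.Prime] : Subring ℚ :=
  (PadicInt.subring p).comap (Rat.castHom ℚ_[p])

theorem mem_padicIntegral {p : ℕ} [Fact p.Prime] {x : ℚ} :
    x ∈ padicIntegral p ↔ ‖(x : ℚ_[p])‖ ≤ 1 := Iff.rfl

theorem inv_natCast_mem_padicIntegral {p n : ℕ} [Fact p.Prime] (hn : ¬ p ∣ n) :
    (n : ℚ)⁻¹ ∈ padicIntegral p := by
  rw [mem_padicIntegral]
  push_cast
  rw [norm_inv, Padic.norm_natCast_eq_one_iff.2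
    ((Nat.Prime.coprime_iff_not_dvd Fact.out).2 hn), inv_one]

theorem padicDvd_one_prime_mul {p : ℕ} [Fact p.Prime] {x : ℚ} (hx : x ∈ padicIntegral p) :
    PadicDvd p 1 (p * x) := by
  have hp : p.Prime := Fact.out
  rcases eq_or_ne x 0 with rfl | h0
  · left; simp
  right
  rw [padicValRat.mul (by exact_mod_cast hp.ne_zero) h0, padicValRat.self hp.one_lt]
  have : 0 ≤ padicValRat p x := by
    rw [mem_padicIntegral, Padic.eq_padicNorm, padicNorm.eq_zpow_of_nonzero h0] at hx
    have hx' : (p : ℚ) ^ (-padicValRat p x) ≤ 1 := by exact_mod_cast hx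
    rw [zpow_le_one_iff_right₀ (by exact_mod_cast hp.one_lt)] at hx'
    lia
  push_cast
  lia

theorem bernoulli_mem_padicIntegral {p : ℕ} [Fact p.Prime] {n : ℕ} (hn : n + 1 < p) :
    bernoulli n ∈ padicIntegral p := by
  induction n using Nat.strong_induction_on with
  | _ n ih =>
    have h := sum_bernoulli (n + 1)
    rw [Finset.sum_range_succ, Nat.choose_succ_self_right] at h
    have hne : ((n + 1 : ℕ) : ℚ) ≠ 0 := by exact_mod_cast n.succ_ne_zero
    have hB : bernoulli n = ((n + 1 : ℕ) : ℚ)⁻¹ * ((if n + 1 = 1 then 1 else 0) -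
        ∑ k ∈ Finset.range n, ((n + 1).choose k : ℚ) * bernoulli k) := by
      rw [← h]; field_simp; ring
    rw [hB]
    refine mul_mem (inv_natCast_mem_padicIntegral (Nat.not_dvd_of_pos_of_lt n.succ_pos hn))
      (sub_mem ?_ (sum_mem fun k hk => mul_mem (natCast_mem _ _) ?_))
    · split_ifs
      exacts [one_mem _, zero_mem _]
    · have := Finset.mem_range.1 hk
      exact ih k this (by lia)

theorem sq_dvd_prod_sub_one_sub_sum {R ι : Type*} [CommRing R] (p : R) (s : Finset ι) (f : ι → R)
    (hf : ∀ i ∈ s, p ∣ f i - 1) :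
    p ^ 2 ∣ ∏ i ∈ s, f i - 1 - ∑ i ∈ s, (f i - 1) := by
  classical
  induction s using Finset.induction_on with
  | empty => simp
  | insert a s ha ih =>
    have hs : ∀ i ∈ s, p ∣ f i - 1 := fun i hi => hf i (Finset.mem_insert_of_mem hi)
    obtain ⟨u, hu⟩ := hf a (Finset.mem_insert_self a s)
    obtain ⟨v, hv⟩ := ih hs
    obtain ⟨w, hw⟩ := Finset.dvd_sum hs
    rw [Finset.prod_insert ha, Finset.sum_insert ha]
    exact ⟨f a * v + u * w, by linear_combination f a * hv + hu * p * w + (f a - 1) * hw⟩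

/-- Lerch's congruence for the sum of the Fermat quotients. -/
theorem sq_dvd_sum_pow_sub_prime_sub_factorial {p : ℕ} (hp : p.Prime) (hodd : Odd p) :
    (p : ℤ) ^ 2 ∣ ∑ a ∈ Finset.range p, (a : ℤ) ^ (p - 1) - p - (p - 1).factorial := by
  have : Fact p.Prime := ⟨hp⟩
  have h1 : 1 ≤ p := hp.one_le
  obtain ⟨x, hx⟩ : (p : ℤ) ∣ (p - 1).factorial + 1 := by
    rw [← ZMod.intCast_zmod_eq_zero_iff_dvd]
    push_cast
    rw [ZMod.wilsons_lemma]; ring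
  have hpow := sq_dvd_prod_sub_one_sub_sum (p : ℤ) (Finset.Ico 1 p)
    (fun a => (a : ℤ) ^ (p - 1)) fun a ha => by
      have ha := Finset.mem_Ico.1 ha
      rw [← ZMod.intCast_zmod_eq_zero_iff_dvd]
      push_cast
      rw [ZMod.pow_card_sub_one_eq_one, sub_self]
      rw [Ne, ZMod.natCast_eq_zero_iff]
      exact Nat.not_dvd_of_pos_of_lt ha.1 ha.2
  have hfac := sq_dvd_prod_sub_one_sub_sum (p : ℤ) (Finset.range (p - 1))
    (fun _ => -((p - 1).factorial : ℤ)) fun _ _ => ⟨-x, by linear_combination -hx⟩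
  have hprod : ∏ a ∈ Finset.Ico 1 p, (a : ℤ) = (p - 1).factorial := by
    rw [← Finset.prod_Ico_id_eq_factorial, Nat.sub_add_cancel h1]
    push_cast; rfl
  have heven : Even (p - 1) := by
    obtain ⟨k, hk⟩ := hodd
    exact ⟨k, by lia⟩
  rw [Finset.prod_pow, hprod, Finset.sum_sub_distrib] at hpow
  rw [Finset.prod_const, Finset.card_range, heven.neg_pow, Finset.sum_const,
    Finset.card_range] at hfac
  simp only [Finset.sum_const, Nat.card_Ico, nsmul_eq_mul, Nat.cast_sub h1] at hpow hfac
  obtain ⟨u, hu⟩ := hpow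
  obtain ⟨v, hv⟩ := hfac
  have hsum : ∑ a ∈ Finset.range p, (a : ℤ) ^ (p - 1)
      = ∑ a ∈ Finset.Ico 1 p, (a : ℤ) ^ (p - 1) := by
    rw [Finset.range_eq_Ico, Finset.sum_eq_sum_Ico_succ_bot hp.pos]
    simp [Nat.sub_ne_zero_of_lt hp.one_lt]
  rw [hsum]
  push_cast at hu hv ⊢
  exact ⟨v - u - x, by linear_combination hv - hu - p * hx⟩

theorem dvd_choose_sub_neg_one_pow {p : ℕ} (hp : p.Prime) {k : ℕ} (hk : k < p) :
    (p : ℤ) ∣ (p - 1).choose k - (-1) ^ k := by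
  induction k with
  | zero => simp
  | succ k ih =>
    have hc : p.choose (k + 1) = (p - 1).choose k + (p - 1).choose (k + 1) := by
      rw [← Nat.choose_succ_succ, Nat.succ_eq_add_one, Nat.sub_add_cancel hp.one_le]
    obtain ⟨u, hu⟩ := hp.dvd_choose_self k.succ_ne_zero hk
    obtain ⟨v, hv⟩ := ih (by lia)
    rw [hu] at hc
    zify at hc
    exact ⟨u - v, by rw [pow_succ]; linear_combination -hc - hv⟩

theorem neg_one_pow_mul_bernoulli_succ (k : ℕ) :
    (-1) ^ k * bernoulli (k + 1) = -bernoulli (k + 1) + if k = 0 then -1 else 0 := by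
  rcases eq_or_ne k 0 with rfl | hk
  · norm_num [bernoulli_one]
  rw [if_neg hk]
  rcases Nat.even_or_odd k with h | h
  · rw [bernoulli_eq_zero_of_odd h.add_one (by lia)]; simp
  · rw [h.neg_one_pow]; ring

theorem padicDvd_sum_divided_bernoulli_sub {p : ℕ} [Fact p.Prime] (hodd : Odd p) :
    PadicDvd p 1 ((∑ k ∈ Finset.Icc 1 (p - 2), bernoulli k / (k : ℚ)) -
      (((p : ℚ) * bernoulli (p - 1) + 1) / p - 1)) := by
  have hp : p.Prime := Fact.out
  obtain ⟨n, rfl⟩ : ∃ n, p = n + 3 := by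
    obtain ⟨k, rfl⟩ := hodd
    have := hp.two_le
    exact ⟨2 * k - 2, by lia⟩
  have hp0 : ((n + 3 : ℕ) : ℚ) ≠ 0 := by positivity
  have hIcc (f : ℕ → ℚ) : ∑ k ∈ Finset.Icc 1 (n + 3 - 2), f k
      = ∑ k ∈ Finset.range (n + 1), f (k + 1) := by
    rw [show n + 3 - 2 = n + 1 by lia, ← Finset.Ico_add_one_right_eq_Icc, Finset.range_eq_Ico,
      Finset.sum_Ico_add' f 0 (n + 1) 1, Nat.zero_add]
  rw [hIcc]
  choose! c hc using fun k (hk : k < n + 3) => dvd_choose_sub_neg_one_pow hp hk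
  have hterm : ∀ k ∈ Finset.range (n + 1),
      ((n + 3).choose (k + 1) : ℚ) * bernoulli (k + 1) = (n + 3 : ℕ) * (
        (n + 3 : ℕ) * (c k * (((k + 1 : ℕ) : ℚ)⁻¹ * bernoulli (k + 1)))
        - bernoulli (k + 1) / (k + 1 : ℕ) + if k = 0 then -1 else 0) := by
    intro k hk
    have hk := Finset.mem_range.1 hk
    have hk0 : ((k + 1 : ℕ) : ℚ) ≠ 0 := by positivity
    have h1 : ((n + 3 : ℕ) : ℚ) * (n + 2).choose k
        = (n + 3).choose (k + 1) * (k + 1 : ℕ) := by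
      exact_mod_cast Nat.add_one_mul_choose_eq (n + 2) k
    have h2 : (((n + 2).choose k : ℕ) : ℚ) - (-1) ^ k = (n + 3 : ℕ) * c k := by
      exact_mod_cast hc k (by lia)
    have h3 := neg_one_pow_mul_bernoulli_succ k
    have h4 : (if k = 0 then (-1 : ℚ) else 0) * (k + 1 : ℕ) = if k = 0 then -1 else 0 := by
      split_ifs with h <;> simp [h]
    refine mul_right_cancel₀ hk0 ?_
    field_simp
    linear_combination -bernoulli (k + 1) * h1 + (n + 3 : ℕ) * bernoulli (k + 1) * h2
      + (n + 3 : ℕ) * h3 - (n + 3 : ℕ) * h4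
  have hrec := sum_bernoulli (n + 3)
  rw [Finset.sum_range_succ, Finset.sum_range_succ', Finset.sum_congr rfl hterm,
    ← Finset.mul_sum, Finset.sum_add_distrib, Finset.sum_sub_distrib, ← Finset.mul_sum,
    Nat.choose_succ_self_right] at hrec
  simp only [Finset.sum_ite_eq', Finset.mem_range, Nat.succ_pos, if_true, Nat.choose_zero_right,
    bernoulli_zero] at hrec
  have key : (∑ k ∈ Finset.range (n + 1), bernoulli (k + 1) / ((k + 1 : ℕ) : ℚ)) -
      ((((n + 3 : ℕ) : ℚ) * bernoulli (n + 3 - 1) + 1) / (n + 3 : ℕ) - 1) = (n + 3 : ℕ) *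
      ∑ k ∈ Finset.range (n + 1), c k * (((k + 1 : ℕ) : ℚ)⁻¹ * bernoulli (k + 1)) := by
    rw [if_neg (by lia)] at hrec
    rw [show n + 3 - 1 = n + 2 by lia]
    refine mul_left_cancel₀ hp0 ?_
    rw [mul_sub, mul_sub, mul_div_cancel₀ _ hp0]
    push_cast at hrec ⊢
    linear_combination -hrec
  rw [key]
  refine padicDvd_one_prime_mul (sum_mem fun k hk => ?_)
  have hk := Finset.mem_range.1 hk
  exact mul_mem (intCast_mem _ _) (mul_mem
    (inv_natCast_mem_padicIntegral (Nat.not_dvd_of_pos_of_lt k.succ_pos (by lia)))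
    (bernoulli_mem_padicIntegral (by lia)))

theorem exists_sum_pow_eq_prime_mul_bernoulli_add {p : ℕ} [Fact p.Prime] (hodd : Odd p) :
    ∃ y ∈ padicIntegral p, ∑ a ∈ Finset.range p, (a : ℚ) ^ (p - 1)
      = p * bernoulli (p - 1) + (p : ℚ) ^ 2 * y := by
  have hp : p.Prime := Fact.out
  obtain ⟨n, rfl⟩ : ∃ n, p = n + 3 := by
    obtain ⟨k, rfl⟩ := hodd
    have := hp.two_le
    exact ⟨2 * k - 2, by lia⟩
  have hp0 : ((n + 3 : ℕ) : ℚ) ≠ 0 := by positivity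
  choose! c hc using fun k (hk : k + 1 < n + 3) => hp.dvd_choose_self k.succ_ne_zero hk
  refine ⟨∑ k ∈ Finset.range (n + 1),
    bernoulli (k + 1) * c k * ((n + 3 : ℕ) : ℚ) ^ (n - k) + ((n + 3 : ℕ) : ℚ) ^ n, ?_, ?_⟩
  · refine add_mem (sum_mem fun k hk => ?_) (pow_mem (natCast_mem _ _) _)
    have hk := Finset.mem_range.1 hk
    exact mul_mem (mul_mem (bernoulli_mem_padicIntegral (by lia)) (natCast_mem _ _))
      (pow_mem (natCast_mem _ _) _)
  · rw [show n + 3 - 1 = n + 2 by lia, sum_range_pow, Finset.sum_range_succ,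
      Finset.sum_range_succ', mul_add, Finset.mul_sum]
    have hd : ((n + 2 : ℕ) : ℚ) + 1 = (n + 3 : ℕ) := by push_cast; ring
    have hterm : ∀ k ∈ Finset.range (n + 1),
        bernoulli (k + 1) * ((n + 2 + 1).choose (k + 1) : ℚ) *
          ((n + 3 : ℕ) : ℚ) ^ (n + 2 + 1 - (k + 1)) / ((n + 2 : ℕ) + 1)
        = ((n + 3 : ℕ) : ℚ) ^ 2 *
          (bernoulli (k + 1) * c k * ((n + 3 : ℕ) : ℚ) ^ (n - k)) := by
      intro k hk
      have hk := Finset.mem_range.1 hk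
      rw [hd, hc k (by lia), show n + 2 + 1 - (k + 1) = (n - k) + 2 by lia, pow_add,
        div_eq_iff hp0, Nat.cast_mul]
      ring
    rw [Finset.sum_congr rfl hterm, hd, Nat.choose_succ_self_right]
    simp only [Nat.choose_zero_right, bernoulli_zero, Nat.sub_zero,
      show n + 2 + 1 - (n + 2) = 1 by lia]
    field_simp
    push_cast
    ring

theorem padicDvd_agohGiuga_sub_wilson {p : ℕ} [Fact p.Prime] (hodd : Odd p) :
    PadicDvd p 1 ((((p : ℚ) * bernoulli (p - 1) + 1) / p - 1) -
      ((Nat.factorial (p - 1) + 1 : ℚ) / p)) := by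
  have hp : p.Prime := Fact.out
  have hp0 : (p : ℚ) ≠ 0 := by exact_mod_cast hp.ne_zero
  obtain ⟨y, hy, hsum⟩ := exists_sum_pow_eq_prime_mul_bernoulli_add hodd
  obtain ⟨z, hz⟩ := sq_dvd_sum_pow_sub_prime_sub_factorial hp hodd
  have hz' : ∑ a ∈ Finset.range p, (a : ℚ) ^ (p - 1) - p - (p - 1).factorial
      = (p : ℚ) ^ 2 * z := by exact_mod_cast hz
  have key : (((p : ℚ) * bernoulli (p - 1) + 1) / p - 1) -
      ((Nat.factorial (p - 1) + 1 : ℚ) / p) = p * (z - y) := by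
    field_simp
    linear_combination hz' - hsum
  rw [key]
  exact padicDvd_one_prime_mul (sub_mem (intCast_mem _ _) hy)


theorem divided_bernoulli_sum_eq_agoh_giuga_sub_one_eq_wilson_quotient
    (p : ℕ) (hp : p.Prime) (hodd : Odd p) :
    PadicDvd p 1 ((∑ k ∈ Finset.Icc 1 (p - 2), bernoulli k / (k : ℚ)) -
      (((p : ℚ) * bernoulli (p - 1) + 1) / p - 1)) ∧
    PadicDvd p 1 ((((p : ℚ) * bernoulli (p - 1) + 1) / p - 1) -
      ((Nat.factorial (p - 1) + 1 : ℚ) / p)) := by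
  have : Fact p.Prime := ⟨hp⟩
  exact ⟨padicDvd_sum_divided_bernoulli_sub hodd, padicDvd_agohGiuga_sub_wilson hodd⟩
end

section
/- Let p be an odd prime. Then Σ_{k even, 1 ≤ k ≤ p−2} B_k/(k·2^k) ≡ 3/4 + Σ_{k even, 1 ≤ k ≤ p−2} (B_k − 1)/k (mod p). -/
/-- `ReducesTo p x a` says that the rational number `x` is `p`-integral and that its residue class
modulo `p` is `a`. -/
def ReducesTo (p : ℕ) [Fact p.Prime] (x : ℚ) (a : ZMod p) : Prop :=
  ∃ z : ℤ_[p], (z : ℚ_[p]) = x ∧ PadicInt.toZMod z = a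

namespace ReducesTo

variable {p : ℕ} [Fact p.Prime] {x y : ℚ} {a b : ZMod p}

theorem unique (h₁ : ReducesTo p x a) (h₂ : ReducesTo p x b) : a = b := by
  obtain ⟨z, hz, rfl⟩ := h₁
  obtain ⟨w, hw, rfl⟩ := h₂
  rw [Subtype.ext (hz.trans hw.symm)]

theorem add (h₁ : ReducesTo p x a) (h₂ : ReducesTo p y b) : ReducesTo p (x + y) (a + b) := by
  obtain ⟨z, hz, rfl⟩ := h₁
  obtain ⟨w, hw, rfl⟩ := h₂
  exact ⟨z + w, by simp [hz, hw], map_add _ _ _⟩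

theorem sub (h₁ : ReducesTo p x a) (h₂ : ReducesTo p y b) : ReducesTo p (x - y) (a - b) := by
  obtain ⟨z, hz, rfl⟩ := h₁
  obtain ⟨w, hw, rfl⟩ := h₂
  exact ⟨z - w, by simp [hz, hw], map_sub _ _ _⟩

theorem mul (h₁ : ReducesTo p x a) (h₂ : ReducesTo p y b) : ReducesTo p (x * y) (a * b) := by
  obtain ⟨z, hz, rfl⟩ := h₁
  obtain ⟨w, hw, rfl⟩ := h₂
  exact ⟨z * w, by simp [hz, hw], map_mul _ _ _⟩

theorem pow (h : ReducesTo p x a) (n : ℕ) : ReducesTo p (x ^ n) (a ^ n) := by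
  obtain ⟨z, hz, rfl⟩ := h
  exact ⟨z ^ n, by simp [hz], map_pow _ _ _⟩

theorem natCast (n : ℕ) : ReducesTo p n n :=
  ⟨n, by simp, map_natCast _ _⟩

theorem one : ReducesTo p 1 1 := by
  simpa using natCast (p := p) 1

theorem inv (h : ReducesTo p x a) (ha : a ≠ 0) : ReducesTo p x⁻¹ a⁻¹ := by
  obtain ⟨z, hz, rfl⟩ := h
  have hu : IsUnit z := by
    by_contra hu
    refine ha ?_
    rw [← RingHom.mem_ker, PadicInt.ker_toZMod]
    exact hu
  obtain ⟨u, rfl⟩ := hu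
  have h1 : ((u : ℤ_[p]) : ℚ_[p]) * ((u⁻¹ : ℤ_[p]ˣ) : ℤ_[p]) = 1 := by
    rw [← PadicInt.coe_mul, Units.mul_inv, PadicInt.coe_one]
  refine ⟨(u⁻¹ : ℤ_[p]ˣ), ?_, ?_⟩
  · rw [Rat.cast_inv, ← hz]
    exact eq_inv_of_mul_eq_one_right h1
  · apply eq_inv_of_mul_eq_one_right
    rw [← map_mul, Units.mul_inv, map_one]

theorem div (h₁ : ReducesTo p x a) (h₂ : ReducesTo p y b) (hb : b ≠ 0) :
    ReducesTo p (x / y) (a / b) := by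
  simpa only [div_eq_mul_inv] using h₁.mul (h₂.inv hb)

theorem sum {ι : Type*} {s : Finset ι} {f : ι → ℚ} {g : ι → ZMod p}
    (h : ∀ i ∈ s, ReducesTo p (f i) (g i)) :
    ReducesTo p (∑ i ∈ s, f i) (∑ i ∈ s, g i) := by
  classical
  induction s using Finset.induction_on with
  | empty => simpa using natCast (p := p) 0
  | insert i s hi ih =>
    rw [Finset.sum_insert hi, Finset.sum_insert hi]
    exact (h i (Finset.mem_insert_self i s)).add
      (ih fun j hj => h j (Finset.mem_insert_of_mem hj))

theorem eq_zero_or_one_le_padicValRat (h : ReducesTo p x 0) :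
    x = 0 ∨ 1 ≤ padicValRat p x := by
  obtain ⟨z, hz, hz0⟩ := h
  rw [← RingHom.mem_ker, PadicInt.ker_toZMod] at hz0
  have hlt : ‖(x : ℚ_[p])‖ < 1 := by
    rw [← hz]
    exact PadicInt.mem_nonunits.mp hz0
  rw [Padic.eq_padicNorm] at hlt
  by_cases hx : x = 0
  · exact Or.inl hx
  · right
    rw [padicNorm.eq_zpow_of_nonzero hx] at hlt
    have hp : (1 : ℚ) < p := by exact_mod_cast (Fact.out : p.Prime).one_lt
    have h2 : (p : ℚ) ^ (-padicValRat p x) < 1 := by exact_mod_cast hlt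
    have := (zpow_lt_one_iff_right₀ hp).mp h2
    omega

end ReducesTo

theorem ZMod.natCast_ne_zero_of_pos_of_lt {p k : ℕ} (hk : 0 < k) (hkp : k < p) :
    (k : ZMod p) ≠ 0 := by
  rw [Ne, ZMod.natCast_eq_zero_iff]
  exact Nat.not_dvd_of_pos_of_lt hk hkp

theorem exists_reducesTo_bernoulli' {p : ℕ} [Fact p.Prime] (n : ℕ) (hn : n + 1 < p) :
    ∃ b : ZMod p, ReducesTo p (bernoulli' n) b := by
  induction n using Nat.strong_induction_on with
  | _ n ih =>
    choose! b hb using fun k (hk : k < n) => ih k hk (by omega)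
    rw [bernoulli'_def]
    refine ⟨_, ReducesTo.one.sub (ReducesTo.sum (g := fun k =>
      (n.choose k : ZMod p) / ((n - k + 1 : ℕ) : ZMod p) * b k) fun k hk => ?_)⟩
    have hk : k < n := Finset.mem_range.mp hk
    have hcast : ((n : ℚ) - k + 1) = ((n - k + 1 : ℕ) : ℚ) := by
      push_cast [Nat.cast_sub hk.le]
      ring
    rw [hcast]
    exact ((ReducesTo.natCast _).div (ReducesTo.natCast _)
      (ZMod.natCast_ne_zero_of_pos_of_lt (by omega) (by omega))).mul (hb k hk)

theorem exists_reducesTo_bernoulli {p : ℕ} [Fact p.Prime] (n : ℕ) (hn : n + 1 < p) :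
    ∃ b : ZMod p, ReducesTo p (bernoulli n) b := by
  obtain ⟨b, hb⟩ := exists_reducesTo_bernoulli' n hn
  have hneg : ReducesTo p (-1) (-1) := by
    simpa using (ReducesTo.natCast (p := p) 0).sub ReducesTo.one
  exact ⟨(-1) ^ n * b, (hneg.pow n).mul hb⟩

theorem exists_reducesTo_bernoulli_eval {p : ℕ} [Fact p.Prime] {x y : ℚ} {a : ZMod p}
    (hx : ReducesTo p x a) (hy : ReducesTo p y a) (n : ℕ) (hn : n + 1 < p) :
    ∃ c : ZMod p, ReducesTo p ((Polynomial.bernoulli n).eval x) c ∧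
      ReducesTo p ((Polynomial.bernoulli n).eval y) c := by
  choose! b hb using fun k (hk : k ≤ n) => exists_reducesTo_bernoulli (p := p) k (by omega)
  have key : ∀ w : ℚ, ReducesTo p w a → ReducesTo p ((Polynomial.bernoulli n).eval w)
      (∑ i ∈ Finset.range (n + 1), b (n - i) * (n.choose i : ZMod p) * a ^ i) := by
    intro w hw
    rw [Polynomial.bernoulli_def, Polynomial.eval_finsetSum]
    refine ReducesTo.sum fun i _ => ?_
    rw [Polynomial.eval_monomial]
    exact ((hb _ (Nat.sub_le n i)).mul (ReducesTo.natCast _)).mul (hw.pow i)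
  exact ⟨_, key x hx, key y hy⟩

open PowerSeries in
theorem bernoulli_polynomial_eval_half (n : ℕ) :
    (Polynomial.bernoulli n).eval (1 / 2 : ℚ) = (2 / 2 ^ n - 1) * bernoulli n := by
  have hF := Polynomial.bernoulli_generating_function (A := ℚ) (1 / 2)
  have hG := bernoulliPowerSeries_mul_exp_sub_one ℚ
  have hH := congrArg (rescale (1 / 2 : ℚ)) hG
  rw [map_mul, map_sub, map_one, rescale_X] at hH
  have he : rescale (1 / 2 : ℚ) (exp ℚ) * rescale (1 / 2 : ℚ) (exp ℚ) = exp ℚ := by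
    rw [exp_mul_exp_eq_exp_add]
    norm_num
  have hne : exp ℚ - 1 ≠ 0 := by
    intro h
    rw [h, mul_zero] at hG
    exact X_ne_zero hG.symm
  have hC : (C (1 / 2 : ℚ)) * 2 = 1 := by
    rw [← map_ofNat (C (R := ℚ)) 2, ← map_mul]
    norm_num
  have key : (mk fun n => Polynomial.aeval (1 / 2 : ℚ) ((1 / n.factorial : ℚ) • Polynomial.bernoulli n)) =
      2 * rescale (1 / 2 : ℚ) (bernoulliPowerSeries ℚ) - bernoulliPowerSeries ℚ := by
    apply mul_right_cancel₀ hne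
    rw [hF, sub_mul, hG]
    linear_combination (-2 * rescale (1 / 2 : ℚ) (exp ℚ) - 2) * hH +
      2 * rescale (1 / 2 : ℚ) (bernoulliPowerSeries ℚ) * he -
      X * (rescale (1 / 2 : ℚ) (exp ℚ) + 1) * hC
  have hn := congrArg (coeff n) key
  rw [← map_ofNat (C (R := ℚ)) 2, map_sub, coeff_C_mul, coeff_rescale, coeff_mk,
    bernoulliPowerSeries, coeff_mk, map_smul, Polynomial.coe_aeval_eq_eval] at hn
  have hf : (n.factorial : ℚ) ≠ 0 := by exact_mod_cast n.factorial_ne_zero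
  simp only [Algebra.algebraMap_self, RingHom.id_apply, smul_eq_mul] at hn
  field_simp at hn
  rw [hn, one_div, inv_pow]
  ring

theorem reducesTo_bernoulli_div_two_pow_sub {n : ℕ} [Fact (2 * n + 1).Prime] (i : ℕ)
    (hi : i + 1 ≤ 2 * n - 1) (h2 : (2 : ZMod (2 * n + 1)) ≠ 0) :
    ReducesTo (2 * n + 1) (bernoulli (i + 1) / (((i + 1 : ℕ) : ℚ) * 2 ^ (i + 1)) -
        bernoulli (i + 1) / ((i + 1 : ℕ) : ℚ))
      (1 / 2 * ∑ j ∈ Finset.range (n + 1), (j : ZMod (2 * n + 1)) ^ i) := by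
  have h2n : (2 * n + 1 : ZMod (2 * n + 1)) = 0 := by
    exact_mod_cast ZMod.natCast_self (2 * n + 1)
  have two : ReducesTo (2 * n + 1) 2 2 := by simpa using ReducesTo.natCast (p := 2 * n + 1) 2
  have hhalf : ReducesTo (2 * n + 1) (1 / 2) ((n + 1 : ℕ) : ZMod (2 * n + 1)) := by
    have h := ReducesTo.one.div two h2
    rwa [show (1 / 2 : ZMod (2 * n + 1)) = ((n + 1 : ℕ) : ZMod (2 * n + 1)) by
      field_simp
      push_cast
      linear_combination -h2n] at h
  have hk : ((i + 1 : ℕ) : ZMod (2 * n + 1)) ≠ 0 :=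
    ZMod.natCast_ne_zero_of_pos_of_lt (by omega) (by omega)
  obtain ⟨c, hc₁, hc₂⟩ := exists_reducesTo_bernoulli_eval hhalf (ReducesTo.natCast (n + 1))
    (i + 1) (by omega)
  obtain ⟨b, hb⟩ := exists_reducesTo_bernoulli (p := 2 * n + 1) (i + 1) (by omega)
  have hsum : ReducesTo (2 * n + 1) (∑ j ∈ Finset.range (n + 1), (j : ℚ) ^ i)
      (∑ j ∈ Finset.range (n + 1), (j : ZMod (2 * n + 1)) ^ i) :=
    ReducesTo.sum fun j _ => (ReducesTo.natCast j).pow i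
  have hF := Polynomial.sum_range_pow_eq_bernoulli_sub (n + 1) i
  have hmod : ((i + 1 : ℕ) : ZMod (2 * n + 1)) *
      ∑ j ∈ Finset.range (n + 1), (j : ZMod (2 * n + 1)) ^ i = c - b := by
    refine ReducesTo.unique ((ReducesTo.natCast (i + 1)).mul hsum) ?_
    push_cast at hF hc₂ ⊢
    rw [hF]
    exact hc₂.sub hb
  have hrat : bernoulli (i + 1) / (((i + 1 : ℕ) : ℚ) * 2 ^ (i + 1)) -
      bernoulli (i + 1) / ((i + 1 : ℕ) : ℚ) = ((Polynomial.bernoulli (i + 1)).eval (1 / 2 : ℚ) -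
        bernoulli (i + 1)) / (2 * ((i + 1 : ℕ) : ℚ)) := by
    rw [bernoulli_polynomial_eval_half]
    have : ((i + 1 : ℕ) : ℚ) ≠ 0 := by positivity
    field_simp
    ring
  rw [hrat]
  have h := (hc₁.sub hb).div (two.mul (ReducesTo.natCast (i + 1))) (mul_ne_zero h2 hk)
  rw [← hmod] at h
  convert h using 1
  field_simp

theorem geom_sum_zmod {n : ℕ} [Fact (2 * n + 1).Prime] (hn : 0 < n) (j : ℕ) (hj : j < n) :
    ∑ i ∈ Finset.range (2 * n - 1), ((j + 1 : ℕ) : ZMod (2 * n + 1)) ^ i =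
      -(((j + 1 : ℕ) : ZMod (2 * n + 1)))⁻¹ - if j = 0 then 1 else 0 := by
  have h2n : (2 * n + 1 : ZMod (2 * n + 1)) = 0 := by
    exact_mod_cast ZMod.natCast_self (2 * n + 1)
  split_ifs with h
  · subst h
    simp only [zero_add, Nat.cast_one, one_pow, Finset.sum_const, Finset.card_range, inv_one,
      nsmul_eq_mul, mul_one]
    rw [Nat.cast_sub (by omega)]
    push_cast
    linear_combination h2n
  · have h0 : ((j + 1 : ℕ) : ZMod (2 * n + 1)) ≠ 0 :=
      ZMod.natCast_ne_zero_of_pos_of_lt (by omega) (by omega)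
    have h1 : (j : ZMod (2 * n + 1)) ≠ 0 :=
      ZMod.natCast_ne_zero_of_pos_of_lt (by omega) (by omega)
    have hg := geom_sum_mul ((j + 1 : ℕ) : ZMod (2 * n + 1)) (2 * n - 1)
    have hf := ZMod.pow_card_sub_one_eq_one h0
    rw [show 2 * n + 1 - 1 = (2 * n - 1) + 1 by omega, pow_succ] at hf
    have hp : ((j + 1 : ℕ) : ZMod (2 * n + 1)) ^ (2 * n - 1) =
        (((j + 1 : ℕ) : ZMod (2 * n + 1)))⁻¹ := eq_inv_of_mul_eq_one_left hf
    rw [hp] at hg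
    apply mul_right_cancel₀ h1
    have hinv := mul_inv_cancel₀ h0
    push_cast at hg hinv ⊢
    linear_combination hg + hinv

theorem sum_sum_pow_zmod {n : ℕ} [Fact (2 * n + 1).Prime] (hn : 0 < n) :
    ∑ i ∈ Finset.range (2 * n - 1), ∑ j ∈ Finset.range (n + 1), (j : ZMod (2 * n + 1)) ^ i =
      2 - ∑ j ∈ Finset.range (n - 1), (((j + 1 : ℕ) : ZMod (2 * n + 1)))⁻¹ := by
  have h2n : (2 * n + 1 : ZMod (2 * n + 1)) = 0 := by
    exact_mod_cast ZMod.natCast_self (2 * n + 1)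
  rw [Finset.sum_comm, Finset.sum_range_succ',
    Finset.sum_congr rfl fun j hj => geom_sum_zmod hn j (Finset.mem_range.mp hj),
    Finset.sum_sub_distrib, Finset.sum_neg_distrib]
  obtain ⟨m, rfl⟩ : ∃ m, n = m + 1 := ⟨n - 1, by omega⟩
  rw [show 2 * (m + 1) - 1 = 2 * m + 1 by omega, Finset.sum_range_succ' _ (2 * m),
    Finset.sum_range_succ _ m]
  have hlast : (((m + 1 : ℕ) : ZMod (2 * (m + 1) + 1)))⁻¹ = -2 := by
    apply inv_eq_of_mul_eq_one_right
    push_cast at h2n ⊢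
    linear_combination -h2n
  rw [hlast]
  simp
  ring

theorem sum_Icc_filter_even {M : Type*} [AddCommMonoid M] (f : ℕ → M) (m : ℕ) :
    ∑ k ∈ (Finset.Icc 1 (2 * m + 1)).filter (fun k => Even k), f k =
      ∑ j ∈ Finset.range m, f (2 * (j + 1)) := by
  symm
  refine Finset.sum_bij (fun j _ => 2 * (j + 1)) ?_ ?_ ?_ fun _ _ => rfl
  · intro j hj
    simp only [Finset.mem_range, Finset.mem_filter, Finset.mem_Icc] at hj ⊢
    exact ⟨by omega, even_two_mul _⟩
  · intro i _ j _ h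
    simpa using h
  · intro k hk
    simp only [Finset.mem_filter, Finset.mem_Icc] at hk
    obtain ⟨hk, r, rfl⟩ := hk
    exact ⟨r - 1, Finset.mem_range.mpr (by omega), by omega⟩

theorem sum_range_two_mul_add_one {M : Type*} [AddCommMonoid M] (f : ℕ → M) (m : ℕ)
    (h : ∀ j, f (2 * (j + 1)) = 0) :
    ∑ i ∈ Finset.range (2 * m + 1), f i = (∑ j ∈ Finset.range m, f (2 * j + 1)) + f 0 := by
  induction m with
  | zero => simp
  | succ m ih =>
    rw [show 2 * (m + 1) + 1 = 2 * m + 1 + 1 + 1 by ring, Finset.sum_range_succ,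
      Finset.sum_range_succ, ih, Finset.sum_range_succ, show 2 * m + 1 + 1 = 2 * (m + 1) by ring,
      h, add_zero, add_right_comm]

theorem even_weighted_bernoulli_sum_eq_three_quarters_plus_shifted_sum
    (p : ℕ) (hp : p.Prime) (hodd : Odd p) :
    PadicDvd p 1 ((∑ k ∈ (Finset.Icc 1 (p - 2)).filter (fun k => Even k),
        bernoulli k / ((k : ℚ) * 2 ^ k)) -
      (3 / 4 + ∑ k ∈ (Finset.Icc 1 (p - 2)).filter (fun k => Even k),
        (bernoulli k - 1) / (k : ℚ))) := by
  obtain ⟨n, rfl⟩ := hodd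
  have : Fact (2 * n + 1).Prime := ⟨hp⟩
  have hn : 0 < n := by
    rcases Nat.eq_zero_or_pos n with rfl | h
    · exact absurd hp (by norm_num)
    · exact h
  have h2 : (2 : ZMod (2 * n + 1)) ≠ 0 := by
    exact_mod_cast ZMod.natCast_ne_zero_of_pos_of_lt (p := 2 * n + 1) two_pos (by omega)
  have two : ReducesTo (2 * n + 1) 2 2 := by simpa using ReducesTo.natCast (p := 2 * n + 1) 2
  have hall := ReducesTo.sum (s := Finset.range (2 * n - 1)) fun i hi =>
    reducesTo_bernoulli_div_two_pow_sub (n := n) i (Finset.mem_range.mp hi) h2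
  rw [← Finset.mul_sum, sum_sum_pow_zmod hn] at hall
  have hharm : ReducesTo (2 * n + 1) (∑ j ∈ Finset.range (n - 1), ((j + 1 : ℕ) : ℚ)⁻¹)
      (∑ j ∈ Finset.range (n - 1), (((j + 1 : ℕ) : ZMod (2 * n + 1)))⁻¹) :=
    ReducesTo.sum fun j hj => (ReducesTo.natCast _).inv
      (ZMod.natCast_ne_zero_of_pos_of_lt (by omega)
        (by have := Finset.mem_range.mp hj; omega))
  have htotal := (hall.add ((ReducesTo.one.div two h2).mul hharm)).sub ReducesTo.one
  rw [show ∀ s : ZMod (2 * n + 1), 1 / 2 * (2 - s) + 1 / 2 * s - 1 = 0 by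
    intro s
    field_simp
    ring] at htotal
  apply ReducesTo.eq_zero_or_one_le_padicValRat
  convert htotal using 1
  obtain ⟨m, rfl⟩ : ∃ m, n = m + 1 := ⟨n - 1, by omega⟩
  rw [show 2 * (m + 1) + 1 - 2 = 2 * m + 1 by omega, show 2 * (m + 1) - 1 = 2 * m + 1 by omega,
    Nat.add_sub_cancel, sum_Icc_filter_even, sum_Icc_filter_even, sum_range_two_mul_add_one _ m
      fun j => by
        rw [bernoulli_eq_zero_of_odd ⟨j + 1, rfl⟩ (by omega), zero_div, zero_div, sub_zero],
    Finset.mul_sum, zero_add, bernoulli_one]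
  have hterm : ∀ j : ℕ, (bernoulli (2 * (j + 1)) - 1) / ((2 * (j + 1) : ℕ) : ℚ) =
      bernoulli (2 * (j + 1)) / ((2 * (j + 1) : ℕ) : ℚ) - 1 / 2 * ((j + 1 : ℕ) : ℚ)⁻¹ := by
    intro j
    push_cast
    field_simp
  rw [Finset.sum_congr rfl fun j _ => hterm j, Finset.sum_sub_distrib, Finset.sum_sub_distrib]
  simp only [show ∀ j, 2 * j + 1 + 1 = 2 * (j + 1) from fun j => rfl]
  norm_num
  ring
end

section
/- Let p be an odd prime. Then the following are equivalent: (a) p is a Wieferich prime, i.e. p^2 divides 2^{p−1} − 1; (b) 2·N_{p−2} ≡ 1 (mod p); (c) Σ_{k odd, 1 ≤ k ≤ p−1} 1/k ≡ 0 (mod p). -/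
open Finset

/-- The number of ascents among the first `k + 1` letters of a word. -/
def wordAscents (s : ℕ → ℕ) (k : ℕ) : ℕ :=
  ∑ i ∈ range k, if s i < s (i + 1) then 1 else 0

/-- Insert the letter `M` at position `j` of a word. -/
def wordInsert (s : ℕ → ℕ) (M j i : ℕ) : ℕ :=
  if i < j then s i else if i = j then M else s (i - 1)

theorem wordAscents_insert_zero {s : ℕ → ℕ} {M k : ℕ} (hs : ∀ i ≤ k, s i < M) :
    wordAscents (wordInsert s M 0) (k + 1) = wordAscents s k := by
  have := hs 0 (by simp)
  rw [wordAscents, sum_range_succ', wordAscents]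
  simp [wordInsert, this.le, -sum_boole]

theorem wordAscents_insert_last {s : ℕ → ℕ} {M k : ℕ} (hs : ∀ i ≤ k, s i < M) :
    wordAscents (wordInsert s M (k + 1)) (k + 1) = wordAscents s k + 1 := by
  have := hs k le_rfl
  rw [wordAscents, sum_range_succ, wordAscents]
  congr 1
  · refine sum_congr rfl fun i hi => ?_
    have := mem_range.1 hi
    simp [wordInsert, show i < k + 1 by omega, this]
  · simp [wordInsert, this]

theorem wordAscents_insert_middle {s : ℕ → ℕ} {M k j : ℕ} (hs : ∀ i ≤ k, s i < M)
    (hj : j < k) :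
    wordAscents (wordInsert s M (j + 1)) (k + 1) =
      if s j < s (j + 1) then wordAscents s k else wordAscents s k + 1 := by
  obtain ⟨b, rfl⟩ : ∃ b, k = j + 1 + b := ⟨k - (j + 1), by omega⟩
  have h1 := hs j (by omega)
  have h2 := hs (j + 1) (by omega)
  have e : j + 1 + b + 1 = j + 1 + 1 + b := by omega
  simp only [wordAscents]
  rw [e, sum_range_add, sum_range_succ, sum_range_succ, sum_range_add, sum_range_succ]
  have hl : ∑ i ∈ range j, (if wordInsert s M (j + 1) i < wordInsert s M (j + 1) (i + 1)
      then 1 else 0) = ∑ i ∈ range j, if s i < s (i + 1) then 1 else 0 := by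
    refine sum_congr rfl fun i hi => ?_
    have := mem_range.1 hi
    simp [wordInsert, show i < j + 1 by omega, this]
  have hr : ∑ i ∈ range b, (if wordInsert s M (j + 1) (j + 1 + 1 + i) <
      wordInsert s M (j + 1) (j + 1 + 1 + i + 1) then 1 else 0) =
      ∑ i ∈ range b, if s (j + 1 + i) < s (j + 1 + i + 1) then 1 else 0 := by
    refine sum_congr rfl fun i _ => ?_
    have a1 : wordInsert s M (j + 1) (j + 1 + 1 + i) = s (j + 1 + i) := by
      rw [wordInsert, if_neg (by omega), if_neg (by omega)]; congr 1; omega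
    have a2 : wordInsert s M (j + 1) (j + 1 + 1 + i + 1) = s (j + 1 + i + 1) := by
      rw [wordInsert, if_neg (by omega), if_neg (by omega)]; congr 1; omega
    rw [a1, a2]
  have m1 : wordInsert s M (j + 1) j = s j := by simp [wordInsert]
  have m2 : wordInsert s M (j + 1) (j + 1) = M := by simp [wordInsert]
  have m3 : wordInsert s M (j + 1) (j + 1 + 1) = s (j + 1) := by simp [wordInsert]
  rw [hl, hr, m1, m2, m3, if_pos h1, if_neg h2.le.not_gt]
  split_ifs <;> omega

theorem sum_pow_wordAscents_insert {R : Type*} [CommRing R] (x : R) {s : ℕ → ℕ} {M k : ℕ}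
    (hs : ∀ i ≤ k, s i < M) :
    ∑ j ∈ range (k + 2), x ^ wordAscents (wordInsert s M j) (k + 1) =
      (wordAscents s k + 1) * x ^ wordAscents s k +
        (k + 1 - wordAscents s k) * x ^ (wordAscents s k + 1) := by
  rw [sum_range_succ, sum_range_succ', wordAscents_insert_zero hs, wordAscents_insert_last hs]
  have h : ∀ j ∈ range k, x ^ wordAscents (wordInsert s M (j + 1)) (k + 1) =
      x ^ (wordAscents s k + 1) + ((if s j < s (j + 1) then 1 else 0 : ℕ) : R) *
        (x ^ wordAscents s k - x ^ (wordAscents s k + 1)) := by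
    intro j hj
    rw [wordAscents_insert_middle hs (mem_range.1 hj)]
    split_ifs <;> simp
  rw [sum_congr rfl h, sum_add_distrib, ← sum_mul, ← Nat.cast_sum, ← wordAscents]
  simp only [sum_const, card_range, nsmul_eq_mul]
  ring

/-- The one-line notation of a permutation, extended by `0`. -/
def permWord {n : ℕ} (σ : Equiv.Perm (Fin n)) (i : ℕ) : ℕ :=
  if h : i < n then σ ⟨i, h⟩ else 0

theorem numAscents_eq_wordAscents {n : ℕ} (σ : Equiv.Perm (Fin n)) :
    numAscents σ = wordAscents (permWord σ) (n - 1) := by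
  rw [numAscents, card_filter, wordAscents, ← Fin.sum_univ_eq_sum_range]
  refine sum_congr rfl fun i _ => ?_
  have := i.isLt
  simp [permWord, show (i : ℕ) < n by omega, show (i : ℕ) + 1 < n by omega]

/-- Insert the new largest letter at position `j` of a permutation. -/
def permInsert {n : ℕ} (j : Fin (n + 1)) (σ : Equiv.Perm (Fin n)) : Equiv.Perm (Fin (n + 1)) :=
  (finSuccEquiv' j).trans ((Equiv.optionCongr σ).trans (finSuccEquiv' (Fin.last n)).symm)

theorem permInsert_self {n : ℕ} (j : Fin (n + 1)) (σ : Equiv.Perm (Fin n)) :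
    permInsert j σ j = Fin.last n := by
  simp [permInsert]

theorem permInsert_succAbove {n : ℕ} (j : Fin (n + 1)) (σ : Equiv.Perm (Fin n)) (i : Fin n) :
    permInsert j σ (j.succAbove i) = (σ i).castSucc := by
  simp [permInsert]

theorem permInsert_bijective (n : ℕ) :
    Function.Bijective fun q : Fin (n + 1) × Equiv.Perm (Fin n) => permInsert q.1 q.2 := by
  rw [Fintype.bijective_iff_injective_and_card]
  constructor
  · rintro ⟨j, σ⟩ ⟨j', σ'⟩ h
    simp only at h
    obtain rfl : j = j' := (permInsert j σ).injective <| by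
      rw [permInsert_self, h, permInsert_self]
    congr 1
    ext i
    have := congrArg (fun τ : Equiv.Perm (Fin (n + 1)) => (τ (j.succAbove i) : ℕ)) h
    simpa [permInsert_succAbove] using this
  · simp [Fintype.card_perm, Nat.factorial_succ]

theorem permWord_permInsert {n : ℕ} (j : Fin (n + 1)) (σ : Equiv.Perm (Fin n)) {i : ℕ}
    (hi : i ≤ n) : permWord (permInsert j σ) i = wordInsert (permWord σ) n j i := by
  rw [permWord, dif_pos (by omega), wordInsert]
  obtain h | h | h := lt_trichotomy i j
  · have e : (⟨i, by omega⟩ : Fin (n + 1)) = j.succAbove ⟨i, by omega⟩ := by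
      rw [Fin.succAbove_of_castSucc_lt _ _ (by simpa [Fin.lt_def] using h)]; rfl
    rw [e, permInsert_succAbove, if_pos h, permWord, dif_pos (by omega), Fin.val_castSucc]
  · have e : (⟨i, by omega⟩ : Fin (n + 1)) = j := Fin.ext h
    rw [e, permInsert_self, if_neg (by omega), if_pos h, Fin.val_last]
  · have e : (⟨i, by omega⟩ : Fin (n + 1)) = j.succAbove ⟨i - 1, by omega⟩ := by
      rw [Fin.succAbove_of_le_castSucc _ _ (by simp [Fin.le_def]; omega)]
      ext; simp; omega
    rw [e, permInsert_succAbove, if_neg (by omega), if_neg (by omega), permWord,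
      dif_pos (by omega), Fin.val_castSucc]

theorem wordAscents_congr {s t : ℕ → ℕ} {k : ℕ} (h : ∀ i ≤ k, s i = t i) :
    wordAscents s k = wordAscents t k := by
  refine sum_congr rfl fun i hi => ?_
  have := mem_range.1 hi
  rw [h i (by omega), h (i + 1) (by omega)]

theorem sum_pow_numAscents_permInsert {R : Type*} [CommRing R] (x : R) {n : ℕ}
    (σ : Equiv.Perm (Fin n)) :
    ∑ j, x ^ numAscents (permInsert j σ) =
      (numAscents σ + 1) * x ^ numAscents σ + (n - numAscents σ) * x ^ (numAscents σ + 1) := by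
  cases n with
  | zero => simp [numAscents]
  | succ k =>
    have hs : ∀ i ≤ k, permWord σ i < k + 1 := fun i hi => by
      rw [permWord, dif_pos (by omega)]; exact Fin.isLt _
    have := sum_pow_wordAscents_insert x hs
    rw [← Fin.sum_univ_eq_sum_range] at this
    rw [numAscents_eq_wordAscents σ]
    push_cast
    rw [← this]
    refine sum_congr rfl fun j _ => ?_
    rw [numAscents_eq_wordAscents, Nat.add_sub_cancel,
      wordAscents_congr fun i hi => permWord_permInsert j σ hi]

open Polynomial in
/-- The Eulerian polynomial, counting permutations by ascents. -/
noncomputable def eulerianPoly (R : Type*) [CommRing R] (n : ℕ) : R[X] :=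
  ∑ σ : Equiv.Perm (Fin n), X ^ numAscents σ

open Polynomial in
theorem eulerianPoly_succ (R : Type*) [CommRing R] (n : ℕ) :
    eulerianPoly R (n + 1) =
      (1 + (n : R[X]) * X) * eulerianPoly R n + X * (1 - X) * derivative (eulerianPoly R n) := by
  rw [eulerianPoly, ← Equiv.sum_comp (Equiv.ofBijective _ (permInsert_bijective n)),
    Fintype.sum_prod_type_right, eulerianPoly, derivative_sum, mul_sum, mul_sum,
    ← sum_add_distrib]
  refine sum_congr rfl fun σ _ => ?_
  simp only [Equiv.ofBijective_apply]
  rw [sum_pow_numAscents_permInsert, derivative_X_pow, map_natCast]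
  cases numAscents σ with
  | zero => simp
  | succ m => rw [Nat.add_sub_cancel]; push_cast; ring

open Polynomial in
/-- Carlitz-style identity for the truncated power sums in characteristic `p`. -/
theorem sum_pow_mul_X_pow (R : Type*) [CommRing R] (p : ℕ) [CharP R p] (n : ℕ) :
    (∑ k ∈ range p, ((k + 1 : ℕ) : R[X]) ^ n * X ^ (k + 1)) * (1 - X) ^ (n + 1) =
      X * eulerianPoly R n * (1 - X ^ p) := by
  induction n with
  | zero =>
    have : eulerianPoly R 0 = 1 := by simp [eulerianPoly, numAscents]
    have h := geom_sum_mul_neg (X : R[X]) p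
    rw [this]
    simp only [pow_zero, one_mul, pow_succ, ← sum_mul]
    linear_combination X * h
  | succ n ih =>
    have hd := congrArg derivative ih
    have hp : (p : R[X]) = 0 := by
      rw [← map_natCast C, CharP.cast_eq_zero, map_zero]
    have hL : X * derivative (∑ k ∈ range p, ((k + 1 : ℕ) : R[X]) ^ n * X ^ (k + 1)) =
        ∑ k ∈ range p, ((k + 1 : ℕ) : R[X]) ^ (n + 1) * X ^ (k + 1) := by
      rw [derivative_sum, mul_sum]
      refine sum_congr rfl fun k _ => ?_
      rw [← Nat.cast_pow, derivative_natCast_mul, derivative_X_pow, map_natCast,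
        Nat.add_sub_cancel]
      push_cast; ring
    rw [← hL, eulerianPoly_succ]
    simp only [derivative_mul, derivative_sub, derivative_one, derivative_X, derivative_pow,
      map_natCast, hp, Nat.add_sub_cancel] at hd
    push_cast at hd ih ⊢
    linear_combination X * (1 - X) * hd + ((n : R[X]) + 1) * X * ih

/-- The sum of the inverses of the odd residues modulo `p`. -/
def oddHarmonic (p : ℕ) : ZMod p :=
  ∑ k ∈ (Icc 1 (p - 1)).filter (fun k => Odd k), (k : ZMod p)⁻¹

theorem natCast_ne_zero_of_mem_Icc {p k : ℕ} (hk : k ∈ Icc 1 (p - 1)) : (k : ZMod p) ≠ 0 := by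
  rw [mem_Icc] at hk
  rw [Ne, ZMod.natCast_eq_zero_iff]
  exact Nat.not_dvd_of_pos_of_lt (by omega) (by omega)

theorem sum_inv_Icc_eq_zero (p : ℕ) [Fact p.Prime] (hodd : Odd p) :
    ∑ k ∈ Icc 1 (p - 1), (k : ZMod p)⁻¹ = 0 := by
  have hp := (Fact.out : p.Prime).two_le
  have h : ∑ k ∈ Icc 1 (p - 1), (k : ZMod p)⁻¹ = ∑ k ∈ Icc 1 (p - 1), -(k : ZMod p)⁻¹ := by
    refine sum_nbij' (fun k => p - k) (fun k => p - k) ?_ ?_ ?_ ?_ ?_ <;> intro k hk <;>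
      rw [mem_Icc] at * <;> try omega
    rw [Nat.cast_sub (by omega), ZMod.natCast_self, zero_sub, inv_neg, neg_neg]
  rw [sum_neg_distrib] at h
  have h2 : (2 : ZMod p) ≠ 0 := Ring.two_ne_zero (by
    rw [ZMod.ringChar_zmod_n]; rintro rfl; exact absurd hodd (by decide))
  refine (mul_eq_zero.1 ?_).resolve_left h2
  linear_combination h

theorem sum_neg_one_pow_mul_inv (p : ℕ) [Fact p.Prime] (hodd : Odd p) :
    ∑ k ∈ Icc 1 (p - 1), (-1) ^ k * (k : ZMod p)⁻¹ = -2 * oddHarmonic p := by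
  have h : ∀ k ∈ Icc 1 (p - 1), (-1) ^ k * (k : ZMod p)⁻¹ =
      (k : ZMod p)⁻¹ - 2 * if Odd k then (k : ZMod p)⁻¹ else 0 := by
    intro k _
    split_ifs with hk
    · rw [hk.neg_one_pow]; ring
    · rw [(Nat.not_odd_iff_even.1 hk).neg_one_pow]; ring
  rw [sum_congr rfl h, sum_sub_distrib, sum_inv_Icc_eq_zero p hodd, ← mul_sum, ← sum_filter,
    oddHarmonic]
  ring

theorem sum_pow_sub_two_mul_neg_one_pow (p : ℕ) [Fact p.Prime] (hodd : Odd p) :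
    ∑ k ∈ range p, ((k + 1 : ℕ) : ZMod p) ^ (p - 2) * (-1) ^ (k + 1) = -2 * oddHarmonic p := by
  have hp := (Fact.out : p.Prime).two_le
  have hp2 : p ≠ 2 := by rintro rfl; exact absurd hodd (by decide)
  rw [← sum_neg_one_pow_mul_inv p hodd]
  obtain ⟨m, rfl⟩ : ∃ m, p = m + 1 := ⟨p - 1, by omega⟩
  rw [sum_range_succ, CharP.cast_eq_zero, zero_pow (by omega), zero_mul, add_zero,
    Nat.add_sub_cancel, range_eq_Ico, sum_Ico_add' (fun k => ((k : ℕ) : ZMod (m + 1)) ^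
      (m + 1 - 2) * (-1) ^ k) 0 m 1, zero_add]
  refine sum_congr (by ext; simp only [mem_Ico, mem_Icc]; omega) fun k hk => ?_
  have hk0 : (k : ZMod (m + 1)) ≠ 0 := natCast_ne_zero_of_mem_Icc (by simp at hk ⊢; omega)
  rw [mul_comm]
  congr 1
  apply eq_inv_of_mul_eq_one_left
  rw [← pow_succ, show m + 1 - 2 + 1 = m + 1 - 1 by omega, ZMod.pow_card_sub_one_eq_one hk0]

theorem cast_choose_sub_one (p : ℕ) [Fact p.Prime] {k : ℕ} (hk : k < p) :
    ((p - 1).choose k : ZMod p) = (-1) ^ k := by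
  induction k with
  | zero => simp
  | succ k ih =>
    have h := Nat.choose_succ_succ (p - 1) k
    have hd : (p.choose (k + 1) : ZMod p) = 0 := by
      rw [ZMod.natCast_eq_zero_iff]
      exact (Fact.out : p.Prime).dvd_choose_self (by omega) hk
    rw [Nat.succ_eq_add_one, Nat.succ_eq_add_one, Nat.sub_add_cancel (by omega)] at h
    rw [h, Nat.cast_add, ih (by omega)] at hd
    rw [pow_succ]
    linear_combination hd

theorem wieferich_iff_oddHarmonic (p : ℕ) [Fact p.Prime] (hodd : Odd p) :
    (p : ℤ) ^ 2 ∣ 2 ^ (p - 1) - 1 ↔ oddHarmonic p = 0 := by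
  have hpp : p.Prime := Fact.out
  have hp := hpp.two_le
  have hp2 : p ≠ 2 := by rintro rfl; exact absurd hodd (by decide)
  have h2 : (2 : ZMod p) ≠ 0 := Ring.two_ne_zero (by rwa [ZMod.ringChar_zmod_n])
  have hq : ∀ k ∈ Icc 1 (p - 1), p * (p.choose k / p) = p.choose k := by
    intro k hk
    rw [mem_Icc] at hk
    exact Nat.mul_div_cancel' (hpp.dvd_choose_self (by omega) (by omega))
  have hsum : (p : ℤ) * ((∑ k ∈ Icc 1 (p - 1), p.choose k / p : ℕ) : ℤ) =
      2 * (2 ^ (p - 1) - 1) := by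
    have h := Nat.sum_range_choose p
    rw [sum_range_succ, range_eq_Ico, sum_eq_sum_Ico_succ_bot (by omega)] at h
    have e : Ico (0 + 1) p = Icc 1 (p - 1) := by ext; simp; omega
    have hpow : 2 ^ p = 2 * 2 ^ (p - 1) := by rw [← pow_succ', Nat.sub_add_cancel (by omega)]
    rw [e, ← sum_congr rfl hq, ← mul_sum, Nat.choose_zero_right, Nat.choose_self, hpow] at h
    zify at h
    push_cast
    linear_combination h
  have hcast : ((∑ k ∈ Icc 1 (p - 1), p.choose k / p : ℕ) : ZMod p) = 2 * oddHarmonic p := by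
    have h := sum_neg_one_pow_mul_inv p hodd
    rw [← neg_inj, ← neg_mul, ← h, Nat.cast_sum, ← sum_neg_distrib]
    refine sum_congr rfl fun k hk => ?_
    have hk0 := natCast_ne_zero_of_mem_Icc hk
    have hk' := mem_Icc.1 hk
    have hc : k * (p.choose k / p) = (p - 1).choose (k - 1) := by
      apply Nat.eq_of_mul_eq_mul_left hpp.pos
      have := Nat.add_one_mul_choose_eq (p - 1) (k - 1)
      rw [Nat.sub_add_cancel (by omega), Nat.sub_add_cancel (by omega)] at this
      rw [this, mul_left_comm, hq k hk, mul_comm]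
    have hc' := congrArg (Nat.cast : ℕ → ZMod p) hc
    rw [Nat.cast_mul, cast_choose_sub_one p (by omega)] at hc'
    have hs : (-1 : ZMod p) ^ k = -(-1) ^ (k - 1) := by
      obtain ⟨m, rfl⟩ : ∃ m, k = m + 1 := ⟨k - 1, by omega⟩
      rw [Nat.add_sub_cancel, pow_succ]; ring
    rw [hs, ← hc']
    field_simp
  have hcop : IsCoprime ((p : ℤ) ^ 2) 2 := by
    apply IsCoprime.pow_left
    exact_mod_cast Nat.isCoprime_iff_coprime.2 (Nat.coprime_two_right.2 hodd)
  have hdvd : (p : ℤ) ^ 2 ∣ 2 ^ (p - 1) - 1 ↔ (p : ℤ) ^ 2 ∣ 2 * (2 ^ (p - 1) - 1) :=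
    ⟨fun h => h.mul_left 2, hcop.dvd_of_dvd_mul_left⟩
  rw [hdvd, ← hsum, sq,
    mul_dvd_mul_iff_left (by exact_mod_cast hpp.ne_zero), Int.natCast_dvd_natCast,
    ← ZMod.natCast_eq_zero_iff, hcast, mul_eq_zero, or_iff_right h2]

theorem padicDvd_one_iff_oddHarmonic (p : ℕ) [Fact p.Prime] :
    PadicDvd p 1 (∑ k ∈ (Icc 1 (p - 1)).filter (fun k => Odd k), (1 : ℚ) / k) ↔
      oddHarmonic p = 0 := by
  have hpp : p.Prime := Fact.out
  set S : ℚ := ∑ k ∈ (Icc 1 (p - 1)).filter (fun k => Odd k), (1 : ℚ) / k with hS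
  set D := (p - 1).factorial
  set M := ∑ k ∈ (Icc 1 (p - 1)).filter (fun k => Odd k), D / k
  have hD : ¬ p ∣ D := by
    rw [hpp.dvd_factorial]; have := hpp.pos; omega
  have hkD : ∀ k ∈ (Icc 1 (p - 1)).filter (fun k => Odd k), k * (D / k) = D := by
    intro k hk
    have hk' := mem_Icc.1 (mem_filter.1 hk).1
    exact Nat.mul_div_cancel' (Nat.dvd_factorial (by omega) hk'.2)
  have hM : (D : ℚ) * S = M := by
    rw [hS, mul_sum, Nat.cast_sum]
    refine sum_congr rfl fun k hk => ?_
    have hk' := mem_Icc.1 (mem_filter.1 hk).1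
    have hk0 : (k : ℚ) ≠ 0 := by exact_mod_cast (show k ≠ 0 by omega)
    rw [← hkD k hk, Nat.cast_mul, Nat.mul_div_cancel_left _ (by omega)]
    field_simp
  have hM' : (D : ZMod p) * oddHarmonic p = M := by
    rw [oddHarmonic, mul_sum, Nat.cast_sum]
    refine sum_congr rfl fun k hk => ?_
    have hk' := mem_Icc.1 (mem_filter.1 hk).1
    have hk0 := natCast_ne_zero_of_mem_Icc (mem_filter.1 hk).1
    rw [← hkD k hk, Nat.cast_mul, Nat.mul_div_cancel_left _ (by omega)]
    field_simp
  have hDz : (D : ZMod p) ≠ 0 := by rwa [Ne, ZMod.natCast_eq_zero_iff]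
  have hDq : (D : ℚ) ≠ 0 := by exact_mod_cast (Nat.factorial_ne_zero (p - 1))
  rw [← or_iff_right (a := (D : ZMod p) = 0) (b := oddHarmonic p = 0) hDz, ← mul_eq_zero, hM',
    ZMod.natCast_eq_zero_iff, PadicDvd]
  by_cases h0 : S = 0
  · have : M = 0 := by rw [h0, mul_zero] at hM; exact_mod_cast hM.symm
    simp [h0, this]
  · have hM0 : M ≠ 0 := by
      intro h
      rw [h, Nat.cast_zero] at hM
      exact (mul_ne_zero hDq h0) hM
    have hv : padicValRat p S = padicValNat p M := by
      have := padicValRat.mul (p := p) hDq h0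
      rw [hM, padicValRat.of_nat, padicValRat.of_nat, padicValNat.eq_zero_of_not_dvd hD] at this
      simpa using this.symm
    rw [or_iff_right h0, hv, Nat.cast_le, dvd_iff_padicValNat_ne_zero hM0]
    omega

open Polynomial in
theorem eulerianPoly_eval_neg_one (p : ℕ) [Fact p.Prime] (hodd : Odd p) :
    (eulerianPoly (ZMod p) (p - 2)).eval (-1) = oddHarmonic p := by
  have hp := (Fact.out : p.Prime).two_le
  have hp2 : p ≠ 2 := by rintro rfl; exact absurd hodd (by decide)
  have h2 : (2 : ZMod p) ≠ 0 := Ring.two_ne_zero (by rwa [ZMod.ringChar_zmod_n])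
  have h := congrArg (eval (-1)) (sum_pow_mul_X_pow (ZMod p) p (p - 2))
  simp only [eval_mul, eval_finsetSum, eval_pow, eval_natCast, eval_X, eval_sub,
    eval_one] at h
  rw [sum_pow_sub_two_mul_neg_one_pow p hodd, hodd.neg_one_pow,
    show p - 2 + 1 = p - 1 by omega, show (1 : ZMod p) - -1 = 2 by ring,
    ZMod.pow_card_sub_one_eq_one h2] at h
  apply mul_left_cancel₀ h2
  linear_combination h

open Polynomial in
theorem two_mul_evenAscentPerms_s14 (R : Type*) [CommRing R] (n : ℕ) :
    (2 * evenAscentPerms n : R) = n.factorial + (eulerianPoly R n).eval (-1) := by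
  have h : ∀ σ : Equiv.Perm (Fin n), (-1 : R) ^ numAscents σ =
      2 * (if Even (numAscents σ) then 1 else 0) - 1 := by
    intro σ
    split_ifs with hσ
    · rw [hσ.neg_one_pow]; ring
    · rw [(Nat.not_even_iff_odd.1 hσ).neg_one_pow]; ring
  simp only [eulerianPoly, eval_finsetSum, eval_pow, eval_X]
  rw [sum_congr rfl fun σ _ => h σ, sum_sub_distrib, ← mul_sum, sum_boole, evenAscentPerms]
  simp [Fintype.card_perm]

theorem cast_factorial_sub_two (p : ℕ) [Fact p.Prime] : ((p - 2).factorial : ZMod p) = 1 := by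
  have hp := (Fact.out : p.Prime).two_le
  have h := ZMod.wilsons_lemma p
  rw [← Nat.mul_factorial_pred (by omega), Nat.cast_mul, Nat.cast_sub (by omega),
    ZMod.natCast_self, show p - 1 - 1 = p - 2 by omega] at h
  push_cast at h
  linear_combination -h

theorem two_mul_evenAscentPerms_modEq_one_iff (p : ℕ) [Fact p.Prime] (hodd : Odd p) :
    2 * evenAscentPerms (p - 2) ≡ 1 [MOD p] ↔ oddHarmonic p = 0 := by
  rw [← ZMod.natCast_eq_natCast_iff, Nat.cast_mul, Nat.cast_two, Nat.cast_one,
    two_mul_evenAscentPerms_s14, cast_factorial_sub_two, eulerianPoly_eval_neg_one p hodd,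
    add_eq_left]

theorem wieferich_prime_combinatorial_characterization
    (p : ℕ) (hp : p.Prime) (hodd : Odd p) :
    ((p : ℤ) ^ 2 ∣ 2 ^ (p - 1) - 1 ↔ 2 * evenAscentPerms (p - 2) ≡ 1 [MOD p]) ∧
    (2 * evenAscentPerms (p - 2) ≡ 1 [MOD p] ↔
      PadicDvd p 1 (∑ k ∈ (Finset.Icc 1 (p - 1)).filter (fun k => Odd k), (1 : ℚ) / k)) := by
  have : Fact p.Prime := ⟨hp⟩
  rw [two_mul_evenAscentPerms_modEq_one_iff p hodd, padicDvd_one_iff_oddHarmonic]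
  exact ⟨wieferich_iff_oddHarmonic p hodd, Iff.rfl⟩
end
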